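/- Let f be an endomorphism of A₁ with P = f(X), Q = f(Y) and image T = f(A₁), and let γ : T → T be the involution on T determined by γ(P) = Q and γ(Q) = P. Suppose that α maps T into T (so α restricted to T is an involution on T), and that there exists g, an automorphism or anti-automorphism of the K-algebra T, such that γ(t) = g⁻¹(α(g(t))) for all t ∈ T. Then f is an automorphism of A₁. -/

import Mathlib

noncomputable section

/-- `f : A → A` is a `K`-algebra endomorphism (as a bare function). -/
def IsAlgEndo (K : Type) [CommSemiring K] {A : Type} [Semiring A] [Algebra K A]
    (f : A → A) : Prop :=
  (∀ a b : A, f (a + b) = f a + f b) ∧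
  (∀ (c : K) (a : A), f (c • a) = c • f a) ∧
  (∀ a b : A, f (a * b) = f a * f b) ∧ f 1 = 1

/-- `f : A → A` is a `K`-algebra automorphism: a bijective endomorphism. -/
def IsAlgAuto (K : Type) [CommSemiring K] {A : Type} [Semiring A] [Algebra K A]
    (f : A → A) : Prop :=
  IsAlgEndo K f ∧ Function.Bijective f

/-- `f : A → A` is a `K`-linear anti-endomorphism. -/
def IsAntiEndo (K : Type) [CommSemiring K] {A : Type} [Semiring A] [Algebra K A]
    (f : A → A) : Prop :=
  (∀ a b : A, f (a + b) = f a + f b) ∧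
  (∀ (c : K) (a : A), f (c • a) = c • f a) ∧
  (∀ a b : A, f (a * b) = f b * f a) ∧ f 1 = 1

/-- `f : A → A` is an anti-automorphism: a bijective anti-endomorphism. -/
def IsAntiAuto (K : Type) [CommSemiring K] {A : Type} [Semiring A] [Algebra K A]
    (f : A → A) : Prop :=
  IsAntiEndo K f ∧ Function.Bijective f

/-- An involution on a `K`-algebra: an anti-automorphism of order at most two. -/
def IsInvolutionOn (K : Type) [CommSemiring K] {A : Type} [Semiring A] [Algebra K A]
    (γ : A → A) : Prop :=
  IsAntiAuto K γ ∧ γ ∘ γ = id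

/-- The defining relation of the first Weyl algebra: `Y*X = X*Y + 1`. -/
inductive WeylRel (K : Type) [CommSemiring K] :
    FreeAlgebra K (Fin 2) → FreeAlgebra K (Fin 2) → Prop
  | rel : WeylRel K (FreeAlgebra.ι K 1 * FreeAlgebra.ι K 0)
      (FreeAlgebra.ι K 0 * FreeAlgebra.ι K 1 + 1)

/-- The first Weyl algebra `A₁(K) = K⟨X,Y⟩/(YX - XY - 1)`. -/
abbrev Weyl (K : Type) [CommSemiring K] : Type := RingQuot (WeylRel K)

/-- The generator `X` of the Weyl algebra. -/
def Wx (K : Type) [CommSemiring K] : Weyl K :=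
  RingQuot.mkAlgHom K (WeylRel K) (FreeAlgebra.ι K 0)

/-- The generator `Y` of the Weyl algebra. -/
def Wy (K : Type) [CommSemiring K] : Weyl K :=
  RingQuot.mkAlgHom K (WeylRel K) (FreeAlgebra.ι K 1)

/-- `α` is the exchange involution: the involution with `α X = Y` and `α Y = X`. -/
def IsExchange (K : Type) [CommSemiring K] (α : Weyl K → Weyl K) : Prop :=
  IsInvolutionOn K α ∧ α (Wx K) = Wy K ∧ α (Wy K) = Wx K

/-- `γ` is conjugate to `α` by an automorphism or an anti-automorphism:
`γ = g⁻¹ ∘ α ∘ g`. -/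
def ConjToAlpha (K : Type) [CommSemiring K] (α γ : Weyl K → Weyl K) : Prop :=
  ∃ g : Weyl K → Weyl K, (IsAlgAuto K g ∨ IsAntiAuto K g) ∧
    γ = Function.invFun g ∘ α ∘ g

section
open Polynomial

section
section basics
variable {R : Type} [CommRing R]

theorem Weyl_rel (R : Type) [CommRing R] : Wy R * Wx R = Wx R * Wy R + 1 := by
  have := RingQuot.mkAlgHom_rel R (WeylRel.rel (K := R))
  simpa [Wx, Wy] using this

def wLift {R : Type} [CommRing R] {B : Type} [Ring B] [Algebra R B] (a b : B) (h : b * a = a * b + 1) :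
    Weyl R →ₐ[R] B :=
  RingQuot.liftAlgHom R ⟨FreeAlgebra.lift R ![a, b], by
    rintro _ _ ⟨⟩
    simpa using h⟩

@[simp] theorem wLift_x {B : Type} [Ring B] [Algebra R B] (a b : B) (h : b * a = a * b + 1) :
    wLift (R := R) a b h (Wx R) = a := by
  simp [wLift, Wx, RingQuot.liftAlgHom_mkAlgHom_apply]

@[simp] theorem wLift_y {B : Type} [Ring B] [Algebra R B] (a b : B) (h : b * a = a * b + 1) :
    wLift (R := R) a b h (Wy R) = b := by
  simp [wLift, Wy, RingQuot.liftAlgHom_mkAlgHom_apply]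

theorem wHom_ext {B : Type} [Semiring B] [Algebra R B] {f g : Weyl R →ₐ[R] B}
    (hx : f (Wx R) = g (Wx R)) (hy : f (Wy R) = g (Wy R)) : f = g := by
  apply RingQuot.ringQuot_ext'
  apply FreeAlgebra.hom_ext
  funext i
  fin_cases i
  · exact hx
  · exact hy

/-- polynomial induction -/
theorem pp_ind {motive : R[X][X] → Prop} (hadd : ∀ f g, motive f → motive g → motive (f + g))
    (hmon : ∀ i j a, motive (monomial i (monomial j a))) (f : R[X][X]) : motive f := by
  induction f using Polynomial.induction_on' with
  | add p q hp hq => exact hadd _ _ hp hq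
  | monomial i c =>
    induction c using Polynomial.induction_on' with
    | add p q hp hq => rw [map_add]; exact hadd _ _ hp hq
    | monomial j a => exact hmon i j a

/-- the operator `∂ + t`. -/
def opP (R : Type) [CommRing R] : Module.End R R[X][X] :=
  (derivative (R := R[X])).restrictScalars R + LinearMap.mulLeft R (C X)

def opQ (R : Type) [CommRing R] : Module.End R R[X][X] := LinearMap.mulLeft R X

theorem opP_apply (f : R[X][X]) : opP R f = derivative f + C X * f := rfl
theorem opQ_apply (f : R[X][X]) : opQ R f = X * f := rfl

def rho (R : Type) [CommRing R] : Weyl R →ₐ[R] Module.End R R[X][X] :=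
  wLift (opQ R) (opP R) (by
    ext1 f
    simp only [Module.End.mul_apply, LinearMap.add_apply, Module.End.one_apply, opP_apply, opQ_apply, derivative_mul, derivative_X]
    ring)

@[simp] theorem rho_x (f : R[X][X]) : rho R (Wx R) f = X * f := by simp [rho, opQ_apply]
@[simp] theorem rho_y (f : R[X][X]) : rho R (Wy R) f = derivative f + C X * f := by simp [rho, opP_apply]

theorem rho_x_pow (i : ℕ) (f : R[X][X]) : rho R (Wx R ^ i) f = X ^ i * f := by
  induction i with
  | zero => simp
  | succ n ih => rw [pow_succ', map_mul, Module.End.mul_apply, ih, rho_x]; ring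

def sig (R : Type) [CommRing R] : Weyl R →ₗ[R] R[X][X] :=
  (LinearMap.applyₗ (1 : R[X][X])).comp (rho R).toLinearMap

theorem sig_apply (w : Weyl R) : sig R w = rho R w 1 := rfl

theorem sig_mul (a b : Weyl R) : sig R (a * b) = rho R a (sig R b) := by
  simp [sig_apply]

theorem sig_y_pow (j : ℕ) : sig R (Wy R ^ j) = C (X ^ j) := by
  induction j with
  | zero => simp [sig_apply]
  | succ n ih => rw [pow_succ', sig_mul, ih, rho_y, derivative_C, zero_add, pow_succ', C_mul]

theorem sig_mon (i j : ℕ) : sig R (Wx R ^ i * Wy R ^ j) = monomial i (monomial j 1) := by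
  rw [sig_mul, sig_y_pow, rho_x_pow, X_pow_mul_C, ← C_mul_X_pow_eq_monomial, X_pow_eq_monomial]

/-- normal ordering map: substitute arbitrary elements -/
def nrm {A : Type} [Ring A] [Algebra R A] (x y : A) : R[X][X] →ₗ[R] A where
  toFun f := f.sum fun i c => c.sum fun j a => a • (x ^ i * y ^ j)
  map_add' f g := by
    refine Polynomial.sum_add_index _ _ _ (by simp) ?_
    intro i c d
    refine Polynomial.sum_add_index _ _ _ (by simp) ?_
    intro j a b
    exact add_smul _ _ _
  map_smul' r f := by
    rw [Polynomial.sum_smul_index']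
    · simp only [RingHom.id_apply, Polynomial.sum_def, Finset.smul_sum]
      refine Finset.sum_congr rfl fun i _ => ?_
      have := Polynomial.sum_smul_index' (f.coeff i) r (fun j (a:R) => a • (x ^ i * y ^ j)) (by simp)
      rw [Polynomial.sum_def, Polynomial.sum_def] at this
      rw [this]
      refine Finset.sum_congr rfl fun j _ => ?_
      rw [smul_assoc]
    · intro i; simp

theorem nrm_mon {A : Type} [Ring A] [Algebra R A] (x y : A) (i j : ℕ) (a : R) :
    nrm x y (monomial i (monomial j a)) = a • (x ^ i * y ^ j) := by
  simp [nrm, Polynomial.sum_monomial_index]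

theorem sig_nrm (f : R[X][X]) : sig R (nrm (Wx R) (Wy R) f) = f := by
  induction f using pp_ind with
  | hadd f g hf hg => simp [hf, hg]
  | hmon i j a => rw [nrm_mon, map_smul, sig_mon, smul_monomial, smul_monomial]; simp


theorem weyl_adjoin (R : Type) [CommRing R] : Algebra.adjoin R {Wx R, Wy R} = ⊤ := by
  set B := Algebra.adjoin R {Wx R, Wy R} with hB
  have hx : Wx R ∈ B := Algebra.subset_adjoin (by simp)
  have hy : Wy R ∈ B := Algebra.subset_adjoin (by simp)
  let φ : Weyl R →ₐ[R] B := wLift ⟨Wx R, hx⟩ ⟨Wy R, hy⟩ (Subtype.ext (Weyl_rel R))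
  have : B.val.comp φ = AlgHom.id R _ := wHom_ext (by simp [φ]) (by simp [φ])
  rw [eq_top_iff]
  intro w _
  have h := DFunLike.congr_fun this w
  simp only [AlgHom.comp_apply, AlgHom.id_apply] at h
  rw [← h]; exact (φ w).2

theorem comm_pow_right {A : Type} [Ring A] {D S : A} (h : D * S = S * D + 1) (i : ℕ) :
    D * S ^ i = S ^ i * D + (i : A) * S ^ (i - 1) := by
  induction i with
  | zero => simp
  | succ n ih =>
    rw [pow_succ, ← mul_assoc, ih, add_mul, mul_assoc, h]
    rcases n with _ | n
    · simp [mul_add]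
    · simp only [Nat.add_sub_cancel, Nat.cast_add, Nat.cast_one]
      rw [mul_assoc _ (S ^ n) S, ← pow_succ]
      noncomm_ring

theorem nrm_rho (w : Weyl R) (f : R[X][X]) :
    nrm (Wx R) (Wy R) (rho R w f) = w * nrm (Wx R) (Wy R) f := by
  have hw : w ∈ Algebra.adjoin R {Wx R, Wy R} := by rw [weyl_adjoin]; trivial
  induction hw using Algebra.adjoin_induction generalizing f with
  | mem x hx =>
    rcases hx with rfl | rfl
    · induction f using pp_ind with
      | hadd f g hf hg => simp only [map_add, hf, hg, mul_add]
      | hmon i j a =>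
        rw [rho_x, X_mul_monomial, nrm_mon, nrm_mon, mul_smul_comm, pow_succ', mul_assoc]
    · induction f using pp_ind with
      | hadd f g hf hg => simp only [map_add, hf, hg, mul_add]
      | hmon i j a =>
        rw [rho_y, derivative_monomial, C_mul_monomial, X_mul_monomial, map_add, nrm_mon, nrm_mon,
          mul_smul_comm, ← mul_assoc, comm_pow_right (Weyl_rel R), ← C_eq_natCast, mul_comm,
          C_mul_monomial, nrm_mon, add_mul, smul_add, mul_assoc (Wx R ^ i), ← pow_succ', add_comm, mul_comm _ a, mul_smul,
          mul_assoc, Nat.cast_smul_eq_nsmul, nsmul_eq_mul]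
  | algebraMap r => simp [Algebra.algebraMap_eq_smul_one]
  | add a b _ _ ha hb => simp only [map_add, LinearMap.add_apply, ha, hb, add_mul]
  | mul a b _ _ ha hb => rw [map_mul, Module.End.mul_apply, ha, hb, mul_assoc]

theorem nrm_sig (w : Weyl R) : nrm (Wx R) (Wy R) (sig R w) = w := by
  rw [sig_apply, nrm_rho]
  have : (1 : R[X][X]) = monomial 0 (monomial 0 1) := rfl
  rw [this, nrm_mon]; simp

theorem sig_inj : Function.Injective (sig R) :=
  Function.LeftInverse.injective nrm_sig

/-- induction on Weyl algebra -/
theorem w_ind {motive : Weyl R → Prop} (hadd : ∀ f g, motive f → motive g → motive (f + g))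
    (hmon : ∀ i j (a : R), motive (a • (Wx R ^ i * Wy R ^ j))) (w : Weyl R) : motive w := by
  rw [← nrm_sig w]
  induction sig R w using pp_ind with
  | hadd f g hf hg => rw [map_add]; exact hadd _ _ hf hg
  | hmon i j a => rw [nrm_mon]; exact hmon i j a

/-- base change -/
def wMap {R R' : Type} [CommRing R] [CommRing R'] (φ : R →+* R') : Weyl R →+* Weyl R' :=
  letI := Algebra.compHom (Weyl R') φ
  (wLift (R := R) (Wx R') (Wy R') (Weyl_rel R')).toRingHom

variable {R' : Type} [CommRing R'] (φ : R →+* R')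

@[simp] theorem wMap_x : wMap φ (Wx R) = Wx R' := by
  letI := Algebra.compHom (Weyl R') φ
  exact wLift_x _ _ _

@[simp] theorem wMap_y : wMap φ (Wy R) = Wy R' := by
  letI := Algebra.compHom (Weyl R') φ
  exact wLift_y _ _ _

theorem wMap_smul (r : R) (w : Weyl R) : wMap φ (r • w) = φ r • wMap φ w := by
  letI := Algebra.compHom (Weyl R') φ
  exact (wLift (R := R) (Wx R') (Wy R') (Weyl_rel R')).toLinearMap.map_smul r w

theorem sig_wMap (w : Weyl R) : sig R' (wMap φ w) = (sig R w).map (mapRingHom φ) := by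
  induction w using w_ind with
  | hadd f g hf hg => simp only [map_add, hf, hg, Polynomial.map_add]
  | hmon i j a =>
    rw [wMap_smul, map_mul, map_pow, map_pow, wMap_x, wMap_y, map_smul, map_smul, sig_mon, sig_mon,
      smul_monomial, smul_monomial, smul_monomial, smul_monomial, map_monomial]
    simp

theorem sig_wMap_coeff (w : Weyl R) (i j : ℕ) :
    ((sig R' (wMap φ w)).coeff i).coeff j = φ (((sig R w).coeff i).coeff j) := by
  rw [sig_wMap]; simp

theorem wMap_inj (hφ : Function.Injective φ) : Function.Injective (wMap φ) := by
  intro a b h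
  apply sig_inj
  ext i j
  apply hφ
  rw [← sig_wMap_coeff, ← sig_wMap_coeff, h]

theorem wMap_surj_of (w : Weyl R') (h : ∀ i j, ((sig R' w).coeff i).coeff j ∈ φ.range) :
    ∃ v, wMap φ v = w := by
  suffices ∀ f : R'[X][X], (∀ i j, (f.coeff i).coeff j ∈ φ.range) →
      ∃ g : R[X][X], g.map (mapRingHom φ) = f by
    obtain ⟨g, hg⟩ := this _ h
    refine ⟨nrm (Wx R) (Wy R) g, sig_inj ?_⟩
    rw [sig_wMap, sig_nrm, hg]
  intro f hf
  have h1 : ∀ i, ∃ c : R[X], c.map φ = f.coeff i := fun i =>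
    (Polynomial.mem_lifts (f.coeff i)).1 ((lifts_iff_coeff_lifts _).2 fun j => hf i j)
  exact (Polynomial.mem_lifts f).1 ((lifts_iff_coeff_lifts _).2 fun i => h1 i)

end basics
end

section
section deg
variable {R : Type} [CommRing R]

/-- coefficients of the symbol -/
def cf (w : Weyl R) (i j : ℕ) : R := ((sig R w).coeff i).coeff j

theorem cf_ext {a b : Weyl R} (h : ∀ i j, cf a i j = cf b i j) : a = b := by
  apply sig_inj; ext i j; exact h i j

theorem opP_pow_C (n : ℕ) : ∀ (f : R[X][X]), (opP R ^ n) f = (aeval (opP R) (X ^ n : R[X])) f := by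
  intro f; simp

theorem rho_eq_sum (w : Weyl R) (f : R[X][X]) :
    rho R w f = (sig R w).sum fun i c => X ^ i * aeval (opP R) c f := by
  induction w using w_ind with
  | hadd a b ha hb =>
    rw [map_add, map_add, LinearMap.add_apply, ha, hb, Polynomial.sum_add_index]
    · intro i; simp
    · intro i c d; simp [mul_add]
  | hmon i j a =>
    rw [map_smul, map_smul, sig_mon, smul_monomial, smul_monomial, sum_monomial_index _ _ (by simp),
      map_mul, LinearMap.smul_apply, Module.End.mul_apply, rho_x_pow, smul_eq_mul, mul_one,
      ← C_mul_X_pow_eq_monomial, map_mul, aeval_C, map_pow, map_pow, aeval_X]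
    simp [rho]

theorem aeval_opP_coeff (b : ℕ) (c : R[X]) (f : R[X][X]) (hf : f.natDegree ≤ b) :
    (aeval (opP R) c f).natDegree ≤ b ∧ (aeval (opP R) c f).coeff b = c * f.coeff b := by
  have hf' : ∀ n, ((opP R ^ n) f).natDegree ≤ b ∧ ((opP R ^ n) f).coeff b = X ^ n * f.coeff b := by
    intro n
    induction n with
    | zero => simp [hf]
    | succ n ih =>
      rw [pow_succ', Module.End.mul_apply, opP_apply]
      set g := (opP R ^ n) f
      constructor
      · refine natDegree_add_le_of_degree_le ?_ ?_
        · exact (natDegree_derivative_le g).trans ((Nat.sub_le _ _).trans ih.1)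
        · exact (natDegree_C_mul_le _ _).trans ih.1
      · rw [coeff_add, coeff_derivative, coeff_C_mul, ih.2, coeff_eq_zero_of_natDegree_lt (by omega)]
        ring
  induction c using Polynomial.induction_on' with
  | add p q hp hq =>
    rw [map_add, LinearMap.add_apply]
    exact ⟨natDegree_add_le_of_degree_le hp.1 hq.1, by rw [coeff_add, hp.2, hq.2, add_mul]⟩
  | monomial n a =>
    rw [← C_mul_X_pow_eq_monomial, map_mul, aeval_C, map_pow, aeval_X, Module.End.mul_apply,
      Module.algebraMap_end_apply]
    refine ⟨(natDegree_smul_le _ _).trans (hf' n).1, ?_⟩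
    rw [coeff_smul, (hf' n).2, smul_eq_C_mul, mul_assoc]

theorem rho_lead (w : Weyl R) (f : R[X][X]) (n b : ℕ) (hw : (sig R w).natDegree ≤ n)
    (hf : f.natDegree ≤ b) :
    (rho R w f).natDegree ≤ n + b ∧ (rho R w f).coeff (n + b) = (sig R w).coeff n * f.coeff b := by
  rw [rho_eq_sum, sum_over_range' _ (by simp) (n+1) (by omega)]
  constructor
  · refine natDegree_sum_le_of_forall_le _ _ fun i hi => ?_
    refine natDegree_mul_le.trans ?_
    have := (aeval_opP_coeff b ((sig R w).coeff i) f hf).1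
    have h2 := natDegree_X_pow_le (R := R[X]) i
    simp at hi
    omega
  · rw [finsetSum_coeff, Finset.sum_range_succ, Finset.sum_eq_zero, zero_add, add_comm,
      coeff_X_pow_mul, (aeval_opP_coeff b ((sig R w).coeff n) f hf).2]
    intro i hi
    simp at hi
    apply coeff_eq_zero_of_natDegree_lt
    refine lt_of_le_of_lt natDegree_mul_le ?_
    have := (aeval_opP_coeff b ((sig R w).coeff i) f hf).1
    have h2 := natDegree_X_pow_le (R := R[X]) i
    omega

theorem sig_lead_mul (w v : Weyl R) (n b : ℕ) (hw : (sig R w).natDegree ≤ n)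
    (hf : (sig R v).natDegree ≤ b) :
    (sig R (w * v)).natDegree ≤ n + b ∧
      (sig R (w * v)).coeff (n + b) = (sig R w).coeff n * (sig R v).coeff b := by
  rw [sig_mul]; exact rho_lead _ _ _ _ hw hf

theorem sig_one : sig R 1 = 1 := by simp [sig_apply]

theorem sig_lead_pow (w : Weyl R) (n : ℕ) (hw : (sig R w).natDegree ≤ n) (l : ℕ) :
    (sig R (w ^ l)).natDegree ≤ l * n ∧
      (sig R (w ^ l)).coeff (l * n) = (sig R w).coeff n ^ l := by
  induction l with
  | zero => simp [sig_one]
  | succ l ih =>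
    have := sig_lead_mul (w ^ l) w (l * n) n ih.1 hw
    rw [ih.2, ← pow_succ, ← pow_succ] at this
    rw [Nat.succ_mul]
    exact this

/-- t-degree bound -/
def tdeg (m : ℕ) (f : R[X][X]) : Prop := ∀ i, (f.coeff i).natDegree ≤ m

theorem tdeg_opP {m : ℕ} {f : R[X][X]} (h : tdeg m f) : tdeg (m+1) (opP R f) := by
  intro i
  rw [opP_apply, coeff_add, coeff_derivative, coeff_C_mul]
  refine natDegree_add_le_of_degree_le ?_ ?_
  · have : ((i:R[X]) + 1) = ((i+1 : ℕ) : R[X]) := by push_cast; rfl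
    rw [this]
    refine natDegree_mul_le.trans ?_
    rw [natDegree_natCast]
    have := h (i+1)
    omega
  · refine natDegree_mul_le.trans ?_
    have := h i
    have := natDegree_X_le (R := R)
    omega

theorem tdeg_rho (w : Weyl R) (f : R[X][X]) (n b : ℕ) (hw : tdeg n (sig R w))
    (hf : tdeg b f) : tdeg (n + b) (rho R w f) := by
  have hp : ∀ j, tdeg (j + b) ((opP R ^ j) f) := by
    intro j
    induction j with
    | zero => simpa using hf
    | succ j ih =>
      rw [pow_succ', Module.End.mul_apply, show j + 1 + b = j + b + 1 by omega]
      exact tdeg_opP ih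
  intro k
  rw [rho_eq_sum, Polynomial.sum_def, finsetSum_coeff]
  refine natDegree_sum_le_of_forall_le _ _ fun i hi => ?_
  rw [coeff_X_pow_mul']
  split_ifs
  · rw [aeval_eq_sum_range, LinearMap.sum_apply, finsetSum_coeff]
    refine natDegree_sum_le_of_forall_le _ _ fun j hj => ?_
    rw [LinearMap.smul_apply, coeff_smul]
    refine (natDegree_smul_le _ _).trans ((hp j _).trans ?_)
    have := hw i
    simp at hj
    omega
  · simp

theorem tdeg_pow (w : Weyl R) (n : ℕ) (hw : tdeg n (sig R w)) (l : ℕ) :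
    tdeg (l * n) (sig R (w ^ l)) := by
  induction l with
  | zero => intro i; rw [pow_zero, sig_one, coeff_one]; split_ifs <;> simp
  | succ l ih =>
    rw [pow_succ', sig_mul, Nat.succ_mul, add_comm]
    exact tdeg_rho _ _ _ _ hw ih

theorem rho_C_mul (w : Weyl R) (c : R[X]) (f : R[X][X]) : rho R w (C c * f) = C c * rho R w f := by
  have hw : w ∈ Algebra.adjoin R {Wx R, Wy R} := by rw [weyl_adjoin]; trivial
  induction hw using Algebra.adjoin_induction generalizing f with
  | mem x hx =>
    rcases hx with rfl | rfl
    · simp; ring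
    · simp; ring
  | algebraMap r => simp [Algebra.algebraMap_eq_smul_one]
  | add a b _ _ ha hb => simp only [map_add, LinearMap.add_apply, ha, hb, mul_add]
  | mul a b _ _ ha hb => rw [map_mul (rho R) a b, Module.End.mul_apply, hb, ha, Module.End.mul_apply]

theorem sig_comm_y (w : Weyl R) : sig R (Wy R * w - w * Wy R) = derivative (sig R w) := by
  rw [map_sub, sig_mul, sig_mul, rho_y]
  have : sig R (Wy R) = C X * 1 := by simp [sig_apply]
  rw [this, rho_C_mul, ← sig_apply]; ring

theorem comm_pow_left {A : Type} [Ring A] {D S : A} (h : D * S = S * D + 1) (i : ℕ) :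
    D ^ i * S = S * D ^ i + (i : A) * D ^ (i - 1) := by
  have h' : (-S) * D = D * (-S) + 1 := by rw [mul_neg, h]; noncomm_ring
  have := comm_pow_right h' i
  rw [mul_neg, neg_mul] at this
  have h2 : (D ^ i * S) = S * D ^ i + (-(S * D ^ i) + D ^ i * S) := by abel
  rw [h2, this]; abel

theorem cf_comm_x (w : Weyl R) (i j : ℕ) :
    cf (w * Wx R - Wx R * w) i j = cf w i (j+1) * (j+1) := by
  unfold cf
  rw [← coeff_derivative]
  congr 1
  induction w using w_ind with
  | hadd a b ha hb =>
    have : (a + b) * Wx R - Wx R * (a + b) = (a * Wx R - Wx R * a) + (b * Wx R - Wx R * b) := by noncomm_ring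
    rw [this, map_add, map_add, coeff_add, coeff_add, ha, hb, derivative_add]
  | hmon m n a =>
    have : (a • (Wx R ^ m * Wy R ^ n)) * Wx R - Wx R * (a • (Wx R ^ m * Wy R ^ n)) =
        (a * n) • (Wx R ^ m * Wy R ^ (n - 1)) := by
      rw [smul_mul_assoc, mul_smul_comm, show ∀ u v : Weyl R, a • u - a • v = a • (u - v) from fun u v => (smul_sub a u v).symm, mul_assoc, comm_pow_left (Weyl_rel R), mul_add,
        ← mul_assoc, ← pow_succ, ← mul_assoc (Wx R), ← pow_succ', add_sub_cancel_left, mul_smul]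
      rw [← nsmul_eq_mul, mul_smul_comm, Nat.cast_smul_eq_nsmul]
    rw [this, map_smul, map_smul, sig_mon, sig_mon]
    simp only [smul_monomial, smul_eq_mul, mul_one, coeff_monomial]
    split_ifs
    · rw [derivative_monomial]
    · simp

theorem cf_comm_y (w : Weyl R) (i j : ℕ) :
    cf (Wy R * w - w * Wy R) i j = cf w (i+1) j * (i+1) := by
  unfold cf
  rw [sig_comm_y, coeff_derivative]
  have : ((i:R[X]) + 1) = C ((i:R) + 1) := by simp
  rw [this, coeff_mul_C]

theorem neg_rel_aux {A : Type} [Ring A] {x y : A} (h : y * x = x * y + 1) :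
    x * (-y) = (-y) * x + 1 := by
  rw [mul_neg, neg_mul, h]; abel

/-- the anti-involution -/
def bet (R : Type) [CommRing R] : Weyl R →ₐ[R] (Weyl R)ᵐᵒᵖ :=
  wLift (MulOpposite.op (Wx R)) (MulOpposite.op (- Wy R)) (by
    apply MulOpposite.unop_injective
    exact neg_rel_aux (Weyl_rel R))

theorem bet_x : bet R (Wx R) = MulOpposite.op (Wx R) := wLift_x _ _ _
theorem bet_y : bet R (Wy R) = MulOpposite.op (-Wy R) := wLift_y _ _ _

theorem wMap_bet {R' : Type} [CommRing R'] (φ : R →+* R') (w : Weyl R) :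
    bet R' (wMap φ w) = MulOpposite.op (wMap φ (bet R w).unop) := by
  induction w using w_ind with
  | hadd f g hf hg => simp only [map_add, hf, hg, MulOpposite.unop_add, MulOpposite.op_add]
  | hmon i j a =>
    simp only [wMap_smul, map_smul, map_mul, map_pow, wMap_x, wMap_y, bet_x, bet_y,
      MulOpposite.unop_smul, MulOpposite.unop_mul, MulOpposite.unop_pow, MulOpposite.unop_op,
      map_neg, MulOpposite.op_smul, MulOpposite.op_mul, MulOpposite.op_pow]

theorem wMap_nrm {R' : Type} [CommRing R'] (φ : R →+* R') (x y : Weyl R) (f : R[X][X]) :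
    wMap φ (nrm x y f) = nrm (wMap φ x) (wMap φ y) (f.map (mapRingHom φ)) := by
  induction f using pp_ind with
  | hadd f g hf hg => simp only [map_add, hf, hg, Polynomial.map_add]
  | hmon i j a =>
    rw [nrm_mon, wMap_smul, map_monomial]
    simp [nrm_mon]

theorem sig_nrm_pow_coeff (l : ℕ) (hl : 0 < l) (F : R[X][X]) (i j : ℕ) :
    cf (nrm (Wx R ^ l) (Wy R ^ l) F) (l * i) (l * j) = (F.coeff i).coeff j := by
  unfold cf
  induction F using pp_ind with
  | hadd f g hf hg => simp only [map_add, hf, hg, coeff_add]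
  | hmon m n a =>
    rw [nrm_mon, ← pow_mul, ← pow_mul, map_smul, sig_mon]
    simp only [smul_monomial, smul_eq_mul, mul_one, coeff_monomial, Nat.mul_right_inj hl.ne']
    split_ifs
    · simp [coeff_monomial, hl.ne']
    · simp

end deg
end

section
section central
variable {R : Type} [CommRing R] (l : ℕ) [Fact l.Prime] [CharP R l]

abbrev MB (R : Type) [CommRing R] := R[X][X]

def lam (R : Type) [CommRing R] (l : ℕ) [Fact l.Prime] [CharP R l] : ZMod l →+* R[X][X] :=
  ((C : R[X] →+* R[X][X]).comp (C : R →+* R[X])).comp (ZMod.castHom dvd_rfl R)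

def Nm (R : Type) [CommRing R] (l : ℕ) [Fact l.Prime] : Module.End (MB R) (ZMod l → MB R) where
  toFun v i := if i = 0 then 0 else v (i - 1)
  map_add' v w := by ext1 i; simp only [Pi.add_apply]; split_ifs <;> simp
  map_smul' r v := by ext1 i; simp only [Pi.smul_apply]; split_ifs <;> simp

def Np (R : Type) [CommRing R] (l : ℕ) [Fact l.Prime] [CharP R l] :
    Module.End (MB R) (ZMod l → MB R) where
  toFun v i := lam R l (i + 1) * v (i + 1)
  map_add' v w := by ext1 i; simp only [Pi.add_apply, mul_add]
  map_smul' r v := by ext1 i; simp only [Pi.smul_apply, smul_eq_mul, RingHom.id_apply]; ring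

theorem Nm_apply (v : ZMod l → MB R) (i) : Nm R l v i = if i = 0 then 0 else v (i - 1) := rfl
theorem Np_apply (v : ZMod l → MB R) (i) : Np R l v i = lam R l (i + 1) * v (i + 1) := rfl

theorem Npm : Np R l * Nm R l = Nm R l * Np R l + 1 := by
  apply LinearMap.ext; intro v; funext i
  simp only [Module.End.mul_apply, LinearMap.add_apply, Module.End.one_apply, Pi.add_apply,
    Nm_apply, Np_apply, add_sub_cancel_right, sub_add_cancel]
  by_cases h0 : i = 0
  · subst h0; simp
  · by_cases h1 : i + 1 = 0
    · have : i = -1 := by linear_combination h1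
      subst this
      simp
      ring
    · rw [if_neg h0, if_neg h1, map_add, map_one]; ring

/-- scalar -/
def sc (r : MB R) : Module.End (MB R) (ZMod l → MB R) := algebraMap _ _ r

def rep (R : Type) [CommRing R] (l : ℕ) [Fact l.Prime] [CharP R l] :
    Weyl R →ₐ[R] Module.End (MB R) (ZMod l → MB R) :=
  wLift (algebraMap (MB R) _ X + Nm R l) (algebraMap (MB R) _ (C X) + Np R l) (by
    have h1 := Algebra.commutes (R := MB R) (A := Module.End (MB R) (ZMod l → MB R)) (X : MB R) (Np R l)
    have h2 := Algebra.commutes (R := MB R) (A := Module.End (MB R) (ZMod l → MB R)) (C X : MB R) (Nm R l)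
    have h3 := Algebra.commutes (R := MB R) (A := Module.End (MB R) (ZMod l → MB R)) (X : MB R)
      (algebraMap (MB R) _ (C X : MB R))
    have h4 := Npm (R := R) l
    rw [add_mul, mul_add, mul_add, add_mul, mul_add, mul_add, h1.symm, h2, h3, h4]
    abel)

theorem rep_x (v : ZMod l → MB R) (i) :
    rep R l (Wx R) v i = X * v i + if i = 0 then 0 else v (i - 1) := by
  simp [rep, Nm_apply]

theorem rep_y (v : ZMod l → MB R) (i) :
    rep R l (Wy R) v i = C X * v i + lam R l (i + 1) * v (i + 1) := by
  simp [rep, Np_apply]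

def e0 (R : Type) [CommRing R] (l : ℕ) [Fact l.Prime] : ZMod l → MB R := Pi.single 0 1

theorem rep_y_e0 (r : MB R) : rep R l (Wy R) (r • e0 R l) = (C X * r) • e0 R l := by
  funext i
  rw [rep_y]
  simp only [e0, Pi.smul_apply, smul_eq_mul]
  by_cases h1 : i + 1 = 0
  · rw [h1]; simp [mul_assoc]
  · rw [Pi.single_eq_of_ne h1]; simp [mul_assoc]

theorem rep_sig (w : Weyl R) : rep R l w (e0 R l) 0 = sig R w := by
  induction w using w_ind with
  | hadd a b ha hb => simp only [map_add, LinearMap.add_apply, Pi.add_apply, ha, hb]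
  | hmon i j a =>
    have hy : ∀ j, rep R l (Wy R ^ j) (e0 R l) = (C X ^ j : MB R) • e0 R l := by
      intro j
      induction j with
      | zero => simp
      | succ j ih => rw [pow_succ', map_mul, Module.End.mul_apply, ih, rep_y_e0, pow_succ']
    have hx : ∀ i v, rep R l (Wx R ^ i) v 0 = X ^ i * v 0 := by
      intro i
      induction i with
      | zero => simp
      | succ i ih => intro v; rw [pow_succ', map_mul, Module.End.mul_apply, rep_x, ih]; simp [pow_succ', mul_assoc]
    rw [map_smul, map_smul, LinearMap.smul_apply, Pi.smul_apply, map_mul, Module.End.mul_apply, hx, hy,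
      sig_mon]
    congr 1
    simp [e0]
    rw [← C_mul_X_pow_eq_monomial, ← X_pow_eq_monomial, C_pow, mul_comm]

theorem rep_inj : Function.Injective (rep R l) := by
  intro a b h
  apply sig_inj
  rw [← rep_sig l, ← rep_sig l, h]

theorem aeval_comm {B A : Type} [CommRing B] [Ring A] [Algebra B A] {D S : A} (h : D * S = S * D + 1)
    (g : B[X]) : aeval D g * S = S * aeval D g + aeval D (derivative g) := by
  induction g using Polynomial.induction_on' with
  | add p q hp hq => simp only [map_add, add_mul, mul_add, hp, hq]; abel
  | monomial n a =>
    rw [derivative_monomial, aeval_monomial, aeval_monomial, mul_assoc, comm_pow_left h, mul_add,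
      ← mul_assoc, Algebra.commutes, mul_assoc, map_mul, map_natCast, mul_assoc (algebraMap B A a)]

theorem unit_cast {B : Type} [CommRing B] [CharP B l] (n : ℕ) (hn : 0 < n) (hl : n < l) : IsUnit (n : B) := by
  have : IsUnit ((ZMod.castHom (dvd_refl l) B) (n : ZMod l)) := by
    apply IsUnit.map
    rw [isUnit_iff_ne_zero, Ne, ZMod.natCast_eq_zero_iff]
    exact fun h => absurd (Nat.le_of_dvd hn h) (by omega)
  simpa using this

theorem aeval_zero {B A : Type} [CommRing B] [CharP B l] [Ring A] [Algebra B A]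
    (hBA : Function.Injective (algebraMap B A)) {D S : A} (h : D * S = S * D + 1)
    (n : ℕ) (hn : n < l) (g : B[X]) (hg : g.natDegree ≤ n) (h0 : aeval D g = 0) : g = 0 := by
  induction n generalizing g with
  | zero =>
    rw [eq_C_of_natDegree_le_zero hg, aeval_C] at h0
    rw [eq_C_of_natDegree_le_zero hg, (map_eq_zero_iff _ hBA).1 h0, C_0]
  | succ n ih =>
    have h1 := aeval_comm h g
    rw [h0, zero_mul, mul_zero, zero_add] at h1
    have h2 := ih (by omega) (derivative g) ((natDegree_derivative_le g).trans (by omega)) h1.symm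
    refine ih (by omega) g ?_ h0
    rw [natDegree_le_iff_coeff_eq_zero]
    intro N hN
    rcases (by omega : N = n + 1 ∨ n + 1 < N) with rfl | h3
    · have h4 : (derivative g).coeff n = 0 := by rw [h2, coeff_zero]
      rw [coeff_derivative] at h4
      have := unit_cast (B := B) l (n + 1) (by omega) hn
      push_cast at this
      exact (this.mul_left_eq_zero).1 h4
    · exact coeff_eq_zero_of_natDegree_lt (by omega)

theorem pow_scalar {B : Type} [CommRing B] [CharP B l] {A : Type} [Ring A] [Algebra B A]
    (hinj : Function.Injective (algebraMap B A)) {D' S' : A} (h' : D' * S' = S' * D' + 1)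
    (f : B[X]) (hm : f.Monic) (hd : f.natDegree = l) (h0 : aeval D' f = 0) :
    ∃ c : B, D' ^ l = algebraMap B A c := by
  have hl : l.Prime := Fact.out
  have h1 := aeval_comm h' f
  rw [h0, zero_mul, mul_zero, zero_add] at h1
  have h2 := aeval_zero l hinj h' (l - 1) (by have := hl.pos; omega) (derivative f)
    ((natDegree_derivative_le f).trans (by omega)) h1.symm
  have h3 : f = X ^ l + C (f.coeff 0) := by
    ext1 n
    rw [coeff_add, coeff_X_pow, coeff_C]
    rcases lt_trichotomy n l with hn | hn | hn
    · rcases Nat.eq_zero_or_pos n with rfl | hp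
      · simp [hl.ne_zero.symm]
      · rw [if_neg (by omega), if_neg (by omega)]
        have h4 : (derivative f).coeff (n-1) = 0 := by rw [h2, coeff_zero]
        rw [coeff_derivative, Nat.sub_add_cancel hp] at h4
        have h5 := unit_cast (B := B) l n hp hn
        have h6 : (((n - 1 : ℕ) : B) + 1) = (n : B) := by
          rw [← Nat.cast_succ]; congr 1; omega
        rw [h6] at h4
        rw [(h5.mul_left_eq_zero).1 h4]; simp
    · subst hn
      rw [if_pos rfl, if_neg hl.ne_zero]
      have := hm.coeff_natDegree
      rw [hd] at this; simp [this]
    · rw [if_neg (by omega), if_neg (by omega), coeff_eq_zero_of_natDegree_lt (by omega)]; simp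
  rw [h3, map_add, map_pow, aeval_X, aeval_C] at h0
  refine ⟨- f.coeff 0, ?_⟩
  rw [map_neg]; exact eq_neg_of_add_eq_zero_left h0

theorem exists_scalar {B : Type} [CommRing B] [Nontrivial B] [CharP B l]
    (D S : Module.End B (ZMod l → B)) (h' : D * S = S * D + 1) :
    ∃ c : B, ∀ v, (D ^ l) v = c • v := by
  have hinj : Function.Injective (algebraMap B (Module.End B (ZMod l → B))) := by
    intro a b hab
    have := congrFun (LinearMap.congr_fun hab (Pi.single 0 1)) 0
    simpa using this
  obtain ⟨c, hc⟩ := pow_scalar l hinj h'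
    (LinearMap.charpoly D) (LinearMap.charpoly_monic D) (by rw [LinearMap.charpoly_natDegree]; simp)
    (LinearMap.aeval_self_charpoly D)
  exact ⟨c, fun v => by rw [hc]; simp⟩

theorem central_pow [Nontrivial R] {D S : Weyl R} (h : D * S = S * D + 1) (w : Weyl R) :
    D ^ l * w = w * D ^ l := by
  have h' : rep R l D * rep R l S = rep R l S * rep R l D + 1 := by
    rw [← map_mul, h, map_add, map_mul, map_one]
  obtain ⟨c, hc⟩ := exists_scalar l (B := MB R) _ _ h'
  apply rep_inj l
  apply LinearMap.ext
  intro v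
  rw [map_mul, map_mul, map_pow, Module.End.mul_apply, Module.End.mul_apply, hc, hc, map_smul]

end central
end

section
section jac
variable {R : Type} [CommRing R]

/-- derivative in the inner variable -/
def dT (R : Type) [CommRing R] : R[X][X] →ₗ[R] R[X][X] where
  toFun f := f.sum fun i c => monomial i (derivative c)
  map_add' f g := by
    refine Polynomial.sum_add_index _ _ _ (by simp) ?_
    intro i c d
    simp
  map_smul' r f := by
    rw [Polynomial.sum_smul_index' _ _ _ (by simp)]
    simp only [RingHom.id_apply, Polynomial.sum_def, Finset.smul_sum]
    refine Finset.sum_congr rfl fun i _ => ?_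
    rw [derivative_smul, smul_monomial]

theorem dT_monomial (i : ℕ) (c : R[X]) : dT R (monomial i c) = monomial i (derivative c) := by
  simp [dT, Polynomial.sum_monomial_index]

theorem dT_coeff (f : R[X][X]) (i : ℕ) : (dT R f).coeff i = derivative (f.coeff i) := by
  induction f using Polynomial.induction_on' with
  | add p q hp hq => rw [map_add, coeff_add, hp, hq, coeff_add, derivative_add]
  | monomial n a =>
    rw [dT_monomial, coeff_monomial, coeff_monomial]; split_ifs <;> simp

def jac (F G : R[X][X]) : R[X][X] := dT R F * derivative G - dT R G * derivative F

variable {A : Type} [Ring A] [Algebra R A] {x y : A} {e : R}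

theorem star_aux (h : y * x = x * y + e • 1) (i : ℕ) :
    y * x ^ i = x ^ i * y + (e * i) • x ^ (i - 1) := by
  induction i with
  | zero => simp
  | succ n ih =>
    rw [pow_succ, ← mul_assoc, ih, add_mul, mul_assoc, h, mul_add, mul_smul_comm, mul_one,
      smul_mul_assoc, ← mul_assoc]
    rcases n with _ | n
    · simp
    · simp only [Nat.add_sub_cancel, ← pow_succ]
      rw [add_assoc, ← add_smul]
      congr 2
      push_cast; ring

theorem star_aux2 (he : e * e = 0) (h : y * x = x * y + e • 1) (j i : ℕ) :
    y ^ j * x ^ i = x ^ i * y ^ j + (e * (j * i)) • (x ^ (i - 1) * y ^ (j - 1)) := by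
  induction j with
  | zero => simp
  | succ n ih =>
    rw [pow_succ', mul_assoc, ih, mul_add, ← mul_assoc, star_aux h, add_mul, mul_assoc, mul_smul_comm,
      ← mul_assoc y, star_aux h, add_mul, smul_add, smul_mul_assoc, smul_mul_assoc, smul_smul]
    have h0 : e * (n * i) * (e * ((i - 1 : ℕ) : R)) = 0 := by linear_combination (n * i) * ((i - 1 : ℕ) : R) * he
    rw [h0, zero_smul, add_zero, add_assoc]
    congr 1
    rcases n with _ | n
    · simp
    · simp only [Nat.add_sub_cancel, mul_assoc, ← pow_succ']
      rw [← add_smul]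
      congr 1
      push_cast; ring

theorem star_mul (he : e * e = 0) (h : y * x = x * y + e • 1) (F G : R[X][X]) :
    nrm x y F * nrm x y G = nrm x y (F * G) + e • nrm x y (dT R F * derivative G) := by
  induction F using pp_ind with
  | hadd f g hf hg => simp only [map_add, add_mul, hf, hg, smul_add]; abel
  | hmon i j a =>
    induction G using pp_ind with
    | hadd f g hf hg => simp only [map_add, mul_add, hf, hg, smul_add]; abel
    | hmon m n b =>
      rw [dT_monomial, derivative_monomial, derivative_monomial, monomial_mul_monomial, monomial_mul_monomial,
        monomial_mul_monomial, ← C_eq_natCast, monomial_mul_C, monomial_mul_monomial, nrm_mon, nrm_mon,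
        nrm_mon, nrm_mon, smul_mul_smul_comm,
        show x ^ i * y ^ j * (x ^ m * y ^ n) = x ^ i * (y ^ j * x ^ m) * y ^ n by simp only [mul_assoc],
        star_aux2 he h, mul_add, add_mul, smul_add, mul_smul_comm, smul_mul_assoc, smul_smul, smul_smul]
      congr 1
      · simp only [pow_add, mul_assoc]
      · rcases m with _ | m
        · simp
        · rcases j with _ | j
          · simp
          · simp only [Nat.add_sub_cancel, pow_add, mul_assoc]
            congr 1
            push_cast; ring

theorem star_comm (he : e * e = 0) (h : y * x = x * y + e • 1) (F G : R[X][X]) :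
    nrm x y F * nrm x y G - nrm x y G * nrm x y F = e • nrm x y (jac F G) := by
  rw [star_mul he h, star_mul he h, mul_comm G F, jac, map_sub, smul_sub]; abel

theorem pow_pow_sig (l : ℕ) (hl : l.Prime) (hR : (l : R) ^ 2 = 0) :
    Wy R ^ l * Wx R ^ l = Wx R ^ l * Wy R ^ l + ((l.factorial : ℕ) : R) • 1 := by
  apply sig_inj
  rw [sig_mul, map_add, sig_mon, map_smul, sig_one]
  have h1 : sig R (Wx R ^ l) = X ^ l := by rw [sig_apply, rho_x_pow, mul_one]
  rw [h1, map_pow (rho R), show rho R (Wy R) = opP R by simp [rho]]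
  have hc : Commute ((derivative (R := R[X])).restrictScalars R) (LinearMap.mulLeft R (C X : R[X][X])) := by
    apply LinearMap.ext; intro f
    simp
  rw [opP, hc.add_pow, LinearMap.sum_apply]
  have hterm : ∀ k, ((derivative (R := R[X])).restrictScalars R ^ k * LinearMap.mulLeft R (C X : R[X][X]) ^ (l - k) *
      ((l.choose k : ℕ) : Module.End R R[X][X])) (X ^ l) =
      ((l.choose k * l.descFactorial k : ℕ) : R[X][X]) * (C X ^ (l - k) * X ^ (l - k)) := by
    intro k
    have : ∀ (n : ℕ) (f : R[X][X]), ((derivative (R := R[X])).restrictScalars R ^ n) f = derivative^[n] f := by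
      intro n
      induction n with
      | zero => simp
      | succ n ih => intro f; rw [pow_succ, Module.End.mul_apply, ih, Function.iterate_succ_apply]; rfl
    rw [mul_assoc, Module.End.mul_apply, Module.End.mul_apply, this, LinearMap.pow_mulLeft,
      LinearMap.mulLeft_apply, Module.End.natCast_apply, ← C_pow, iterate_derivative_C_mul]
    rw [nsmul_eq_mul, ← C_eq_natCast, iterate_derivative_C_mul,
      iterate_derivative_X_pow_eq_natCast_mul]
    push_cast
    simp only [C_eq_natCast]
    ring
  rw [Finset.sum_congr rfl fun k _ => hterm k, Finset.sum_range_succ,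
    Finset.sum_eq_single_of_mem 0 (by simp [hl.pos])]
  · simp [Nat.descFactorial_self]
    rw [add_comm, ← C_mul_X_pow_eq_monomial, ← X_pow_eq_monomial, C_pow, add_comm]
    rw [Nat.cast_smul_eq_nsmul, nsmul_eq_mul, mul_one]
  · intro k' hk hk0
    obtain ⟨k, rfl⟩ : ∃ k, k' = k + 1 := ⟨k' - 1, by omega⟩
    simp at hk
    obtain ⟨a, ha⟩ := hl.dvd_choose_self (k := k + 1) (by omega) (by omega)
    rw [Nat.descFactorial_eq_factorial_mul_choose, ha]
    have : ((l : ℕ) : R[X][X]) ^ 2 = 0 := by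
      rw [← C_eq_natCast, ← C_eq_natCast, ← C_pow, ← C_pow, hR]; simp
    push_cast
    linear_combination (a ^ 2 * ((k+1).factorial : R[X][X]) * (C X ^ (l - (k+1)) * X ^ (l - (k+1)))) * this

theorem pow_pow_comm (l : ℕ) (hl : l.Prime) (hR : (l : R) ^ 2 = 0) {D S : A} (h : D * S = S * D + 1) :
    D ^ l * S ^ l = S ^ l * D ^ l + ((l.factorial : ℕ) : R) • 1 := by
  have := congrArg (wLift (R := R) S D h) (pow_pow_sig l hl hR)
  simpa using this

end jac
end

section
section lift
variable {R R1 : Type} [CommRing R] [CommRing R1] (l : ℕ) [Fact l.Prime] [CharP R1 l] [Nontrivial R1]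
  (φ : R →+* R1)

theorem unit_cast' {B : Type} [CommRing B] (l : ℕ) [Fact l.Prime] [CharP B l] (n : ℕ) (hn : ¬ l ∣ n) : IsUnit (n : B) := by
  have : IsUnit ((ZMod.castHom (dvd_refl l) B) (n : ZMod l)) := by
    apply IsUnit.map
    rw [isUnit_iff_ne_zero, Ne, ZMod.natCast_eq_zero_iff]
    exact hn
  simpa using this

theorem mem_of_cf {R : Type} [CommRing R] (M : Submodule R (Weyl R)) (w : Weyl R)
    (h : ∀ i j, cf w i j • (Wx R ^ i * Wy R ^ j) ∈ M) : w ∈ M := by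
  rw [← nrm_sig w]
  exact Submodule.sum_mem _ fun i _ => Submodule.sum_mem _ fun j _ => h i j

theorem lift_zero {R R1 : Type} [CommRing R] [CommRing R1] (l : ℕ) (φ : R →+* R1)
    (hφ : ∀ r, φ r = 0 → ∃ s, r = l * s) (w : Weyl R) (hw : wMap φ w = 0) :
    ∃ z, w = (l : R) • z := by
  have : w ∈ LinearMap.range (LinearMap.lsmul R (Weyl R) (l : R)) := by
    apply mem_of_cf
    intro i j
    have : φ (cf w i j) = 0 := by
      rw [cf, ← sig_wMap_coeff, hw]; simp
    obtain ⟨s, hs⟩ := hφ _ this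
    exact ⟨s • (Wx R ^ i * Wy R ^ j), by rw [hs, mul_smul]; rfl⟩
  obtain ⟨z, hz⟩ := this
  exact ⟨z, hz.symm⟩

theorem lift_central (hφ : ∀ r, φ r = 0 → ∃ s, r = l * s) (w : Weyl R)
    (hw : ∀ v, wMap φ w * v = v * wMap φ w) :
    ∃ (F : R[X][X]) (a : Weyl R), w = nrm (Wx R ^ l) (Wy R ^ l) F + (l : R) • a := by
  have : w ∈ LinearMap.range (nrm (R := R) (Wx R ^ l) (Wy R ^ l)) ⊔
      LinearMap.range (LinearMap.lsmul R (Weyl R) (l : R)) := by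
    apply mem_of_cf
    intro i j
    by_cases h : l ∣ i ∧ l ∣ j
    · obtain ⟨⟨i, rfl⟩, j, rfl⟩ := h
      apply Submodule.mem_sup_left
      exact ⟨monomial i (monomial j (cf w (l * i) (l * j))), by rw [nrm_mon, pow_mul, pow_mul]⟩
    · apply Submodule.mem_sup_right
      have : φ (cf w i j) = 0 := by
        have h0 : φ (cf w i j) = cf (wMap φ w) i j := by rw [cf, ← sig_wMap_coeff]; rfl
        rw [h0]
        rw [not_and_or] at h
        rcases h with h | h
        · obtain ⟨i, rfl⟩ : ∃ k, i = k + 1 := ⟨i - 1, by rcases i with _ | i; simp at h; omega⟩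
          have h1 := cf_comm_y (wMap φ w) i j
          rw [hw, sub_self] at h1
          have h2 := unit_cast' (B := R1) l (i + 1) h
          push_cast at h2
          refine (h2.mul_left_eq_zero).1 ?_
          rw [← h1]; simp [cf]
        · obtain ⟨j, rfl⟩ : ∃ k, j = k + 1 := ⟨j - 1, by rcases j with _ | j; simp at h; omega⟩
          have h1 := cf_comm_x (wMap φ w) i j
          rw [hw, sub_self] at h1
          have h2 := unit_cast' (B := R1) l (j + 1) h
          push_cast at h2
          refine (h2.mul_left_eq_zero).1 ?_
          rw [← h1]; simp [cf]
      obtain ⟨s, hs⟩ := hφ _ this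
      exact ⟨s • (Wx R ^ i * Wy R ^ j), by rw [hs, mul_smul]; rfl⟩
  obtain ⟨_, ⟨F, rfl⟩, _, ⟨a, rfl⟩, h⟩ := Submodule.mem_sup.1 this
  exact ⟨F, a, h.symm⟩

theorem comm_reduce {R A : Type} [CommRing R] [Ring A] [Algebra R A] (e : R) (he : e ^ 2 = 0)
    {u v u0 v0 a b : A} (hu : u = u0 + e • a) (hv : v = v0 + e • b)
    (h1 : ∃ z, u * b - b * u = e • z) (h2 : ∃ z, v * a - a * v = e • z) :
    u * v - v * u = u0 * v0 - v0 * u0 := by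
  obtain ⟨z, hz⟩ := h1
  obtain ⟨z', hz'⟩ := h2
  have k0 : ∀ t : A, e • e • t = 0 := fun t => by rw [smul_smul, ← sq, he, zero_smul]
  have hu0 : u0 = u - e • a := by rw [hu]; abel
  have hv0 : v0 = v - e • b := by rw [hv]; abel
  have e1 : e • (u * b) - e • (b * u) = 0 := by rw [← smul_sub, hz, k0]
  have e2 : e • (v * a) - e • (a * v) = 0 := by rw [← smul_sub, hz', k0]
  rw [hu0, hv0]
  simp only [sub_mul, mul_sub, smul_mul_assoc, mul_smul_comm, smul_sub, k0, sub_zero]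
  have : u * v - v * u = (u * v - v * u) - (e • (u * b) - e • (b * u)) + (e • (v * a) - e • (a * v)) := by
    rw [e1, e2]; abel
  rw [this]; abel

theorem jac_lift (hφ : ∀ r, φ r = 0 → ∃ s, r = l * s) (hR : (l : R) ^ 2 = 0)
    {D S : Weyl R} (h : D * S = S * D + 1) :
    ∃ (F G : R[X][X]) (a b : Weyl R), D ^ l = nrm (Wx R ^ l) (Wy R ^ l) F + (l : R) • a ∧
      S ^ l = nrm (Wx R ^ l) (Wy R ^ l) G + (l : R) • b ∧
      ((l.factorial : ℕ) : R) • (jac F G - 1) = 0 := by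
  have hl : l.Prime := Fact.out
  have h1 : wMap φ D * wMap φ S = wMap φ S * wMap φ D + 1 := by
    rw [← map_mul, h, map_add, map_mul, map_one]
  have h1' : wMap φ S * (-wMap φ D) = (-wMap φ D) * wMap φ S + 1 := neg_rel_aux h1
  have hD : ∀ v, wMap φ (D ^ l) * v = v * wMap φ (D ^ l) := by
    intro v; rw [map_pow]; exact central_pow l h1 v
  have hS : ∀ v, wMap φ (S ^ l) * v = v * wMap φ (S ^ l) := by
    intro v; rw [map_pow]; exact central_pow l h1' v
  obtain ⟨F, a, hF⟩ := lift_central l φ hφ _ hD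
  obtain ⟨G, b, hG⟩ := lift_central l φ hφ _ hS
  refine ⟨F, G, a, b, hF, hG, ?_⟩
  have hl2 : ((l.factorial : ℕ) : R) * ((l.factorial : ℕ) : R) = 0 := by
    obtain ⟨t, ht⟩ := Nat.dvd_factorial hl.pos le_rfl
    rw [ht]; push_cast; linear_combination (t : R) ^ 2 * hR
  have c1 := pow_pow_comm (R := R) l hl hR h
  have c2 := pow_pow_comm (R := R) l hl hR (Weyl_rel R)
  have c3 := star_comm hl2 c2 F G
  have c4 := comm_reduce (l : R) hR hF hG
    (lift_zero l φ hφ _ (by rw [map_sub, map_mul, map_mul, hD, sub_self]))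
    (lift_zero l φ hφ _ (by rw [map_sub, map_mul, map_mul, hS, sub_self]))
  replace c3 := c4.trans c3
  rw [c1, add_sub_cancel_left] at c3
  ext i j
  have c5 := congrArg (fun w => cf w (l * i) (l * j)) c3
  have c6 : (1 : Weyl R) = nrm (Wx R ^ l) (Wy R ^ l) (1 : R[X][X]) := by
    have : (1 : R[X][X]) = monomial 0 (monomial 0 1) := rfl
    rw [this, nrm_mon]; simp
  rw [c6] at c5
  simp only [cf, map_smul, coeff_smul] at c5
  have c7 := sig_nrm_pow_coeff l hl.pos (1 : R[X][X]) i j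
  have c8 := sig_nrm_pow_coeff l hl.pos (jac F G) i j
  simp only [cf] at c7 c8
  rw [c7, c8] at c5
  simp only [coeff_smul, coeff_sub, smul_sub, c5, sub_self, coeff_zero]

end lift
end

section
section polygon
variable {k : Type} [Field k]

theorem polygon (f g : ℕ → ℕ → k) (M : ℕ) (hfM : ∀ i j, f i j ≠ 0 → i < M ∧ j < M)
    (hgM : ∀ i j, g i j ≠ 0 → i < M ∧ j < M) (hf0 : ∀ i, f i 0 = 0)
    (hf1 : ∀ i, 1 ≤ i → f i 1 = 0) (hf01 : f 0 1 ≠ 0) (hg10 : g 1 0 ≠ 0)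
    (hg0 : ∀ i, 2 ≤ i → g i 0 = 0)
    (hE : ∀ a b, ¬ (a = 1 ∧ b = 1) → ∑ p ∈ Finset.HasAntidiagonal.antidiagonal a, ∑ r ∈ Finset.HasAntidiagonal.antidiagonal b,
      f p.1 r.1 * g p.2 r.2 * ((r.1 : k) * p.2 - r.2 * p.1) = 0)
    (hN : ∀ i j i' j', 1 ≤ i' → f i j ≠ 0 → g i' j' ≠ 0 → (j : k) + i' - 1 ≠ 0) :
    (∀ i j, 1 ≤ i → f i j = 0) ∧ (∀ i j, 2 ≤ i → g i j = 0) := by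
  classical
  by_contra hcon
  have hbad : (∃ i j, 1 ≤ i ∧ f i j ≠ 0) ∨ (∃ i j, 2 ≤ i ∧ g i j ≠ 0) := by
    by_contra h
    push Not at h
    exact hcon h
  -- the slope
  obtain ⟨m, n, hm, hn, hF, hG, hex⟩ : ∃ m n : ℤ, 1 ≤ m ∧ 1 ≤ n ∧
      (∀ i j, f i j ≠ 0 → n * i ≤ m * ((j : ℤ) - 1)) ∧
      (∀ i j, g i j ≠ 0 → n * ((i : ℤ) - 1) ≤ m * j) ∧
      ((∃ i j : ℕ, f i j ≠ 0 ∧ (i : ℤ) = m ∧ (j : ℤ) - 1 = n) ∨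
       (∃ i j : ℕ, g i j ≠ 0 ∧ (i : ℤ) - 1 = m ∧ (j : ℤ) = n)) := by
    let P := (Finset.range M ×ˢ Finset.range M)
    let V : Finset (ℤ × ℤ) := ((P.filter fun p => f p.1 p.2 ≠ 0).image fun p => ((p.1 : ℤ), (p.2 : ℤ) - 1)) ∪
      ((P.filter fun p => g p.1 p.2 ≠ 0).image fun p => ((p.1 : ℤ) - 1, (p.2 : ℤ)))
    have hVf : ∀ i j, f i j ≠ 0 → ((i : ℤ), (j : ℤ) - 1) ∈ V := by
      intro i j h
      apply Finset.mem_union_left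
      refine Finset.mem_image.2 ⟨(i, j), ?_, rfl⟩
      simp [P, h, hfM i j h]
    have hVg : ∀ i j, g i j ≠ 0 → ((i : ℤ) - 1, (j : ℤ)) ∈ V := by
      intro i j h
      apply Finset.mem_union_right
      refine Finset.mem_image.2 ⟨(i, j), ?_, rfl⟩
      simp [P, h, hgM i j h]
    have hV : ∀ v ∈ V, (∃ i j : ℕ, f i j ≠ 0 ∧ (i : ℤ) = v.1 ∧ (j : ℤ) - 1 = v.2) ∨
       (∃ i j : ℕ, g i j ≠ 0 ∧ (i : ℤ) - 1 = v.1 ∧ (j : ℤ) = v.2) := by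
      intro v hv
      rcases Finset.mem_union.1 hv with hv | hv
      · obtain ⟨p, hp, rfl⟩ := Finset.mem_image.1 hv
        exact Or.inl ⟨p.1, p.2, (Finset.mem_filter.1 hp).2, rfl, rfl⟩
      · obtain ⟨p, hp, rfl⟩ := Finset.mem_image.1 hv
        exact Or.inr ⟨p.1, p.2, (Finset.mem_filter.1 hp).2, rfl, rfl⟩
    have hV0 : ∀ v ∈ V, 0 ≤ v.2 ∧ (1 ≤ v.1 → 1 ≤ v.2) := by
      intro v hv
      rcases hV v hv with ⟨i, j, h, h1, h2⟩ | ⟨i, j, h, h1, h2⟩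
      · have a1 : j ≠ 0 := by rintro rfl; exact h (hf0 i)
        have a2 : 1 ≤ i → j ≠ 1 := by rintro hi rfl; exact h (hf1 i hi)
        omega
      · have a2 : 2 ≤ i → j ≠ 0 := by rintro hi rfl; exact h (hg0 i hi)
        omega
    have hne : (V.filter fun v => 1 ≤ v.1).Nonempty := by
      rcases hbad with ⟨i, j, hi, h⟩ | ⟨i, j, hi, h⟩
      · exact ⟨_, Finset.mem_filter.2 ⟨hVf i j h, by simpa using hi⟩⟩
      · exact ⟨_, Finset.mem_filter.2 ⟨hVg i j h, by simp; omega⟩⟩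
    obtain ⟨v, hv, hmin⟩ := Finset.exists_min_image _ (fun v : ℤ × ℤ => (v.2 : ℚ) / v.1) hne
    obtain ⟨hvV, hv1⟩ := Finset.mem_filter.1 hv
    have key : ∀ u ∈ V, v.2 * u.1 ≤ v.1 * u.2 := by
      intro u hu
      have hu0 := hV0 u hu
      have hv0 := hV0 v hvV
      by_cases h1 : 1 ≤ u.1
      · have := hmin u (Finset.mem_filter.2 ⟨hu, h1⟩)
        rw [div_le_div_iff₀ (by exact_mod_cast hv1) (by exact_mod_cast h1)] at this
        have h2 : v.2 * u.1 ≤ u.2 * v.1 := by exact_mod_cast this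
        linarith
      · nlinarith [hv0.2 hv1]
    refine ⟨v.1, v.2, hv1, (hV0 v hvV).2 hv1, fun i j h => key _ (hVf i j h),
      fun i j h => key _ (hVg i j h), hV v hvV⟩
  -- tops
  obtain ⟨i0, j0, hf, hw0, hmax0⟩ : ∃ i0 j0, f i0 j0 ≠ 0 ∧ n * i0 = m * ((j0 : ℤ) - 1) ∧
      ∀ i j, f i j ≠ 0 → n * i = m * ((j : ℤ) - 1) → j ≤ j0 := by
    obtain ⟨p, hp, hpm⟩ := Finset.exists_max_image ((Finset.range M ×ˢ Finset.range M).filter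
      fun p => f p.1 p.2 ≠ 0 ∧ n * p.1 = m * ((p.2 : ℤ) - 1)) (fun p => p.2)
      ⟨(0, 1), by have := hfM _ _ hf01; simp [hf01, this]⟩
    have hp2 := (Finset.mem_filter.1 hp).2
    refine ⟨p.1, p.2, hp2.1, hp2.2, fun i j h h' => hpm (i, j) ?_⟩
    have := hfM _ _ h
    exact Finset.mem_filter.2 ⟨by simp [this], h, h'⟩
  obtain ⟨i1, j1, hg, hw1, hmax1⟩ : ∃ i0 j0, g i0 j0 ≠ 0 ∧ n * ((i0 : ℤ) - 1) = m * (j0 : ℤ) ∧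
      ∀ i j, g i j ≠ 0 → n * ((i : ℤ) - 1) = m * (j : ℤ) → j ≤ j0 := by
    obtain ⟨p, hp, hpm⟩ := Finset.exists_max_image ((Finset.range M ×ˢ Finset.range M).filter
      fun p => g p.1 p.2 ≠ 0 ∧ n * ((p.1 : ℤ) - 1) = m * (p.2 : ℤ)) (fun p => p.2)
      ⟨(1, 0), by have := hgM _ _ hg10; simp [hg10, this]⟩
    have hp2 := (Finset.mem_filter.1 hp).2
    refine ⟨p.1, p.2, hp2.1, hp2.2, fun i j h h' => hpm (i, j) ?_⟩
    have := hgM _ _ h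
    exact Finset.mem_filter.2 ⟨by simp [this], h, h'⟩
  have hj0 : j0 ≠ 0 := by rintro rfl; exact hf (hf0 _)
  have hne : ¬ (i0 + i1 = 1 ∧ j0 + j1 = 1) := by
    rcases hex with ⟨i, j, h, h1, h2⟩ | ⟨i, j, h, h1, h2⟩
    · have := hmax0 i j h (by rw [h1, h2]; ring)
      omega
    · have := hmax1 i j h (by rw [h1, h2]; ring)
      omega
  have hsum := hE _ _ hne
  rw [Finset.sum_eq_single (i0, i1), Finset.sum_eq_single (j0, j1)] at hsum
  · simp only at hsum
    have hi1 : 1 ≤ i1 := by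
      by_contra h
      have h0 : i1 = 0 := by omega
      rw [h0] at hw1
      push_cast at hw1
      nlinarith
    have hz : (j0 : ℤ) * i1 - j1 * i0 = j0 + i1 - 1 := by
      have : n * ((j0 : ℤ) * i1 - j1 * i0 - (j0 + i1 - 1)) = 0 := by
        linear_combination ((j0 : ℤ) - 1) * hw1 - j1 * hw0
      rcases mul_eq_zero.1 this with h | h
      · omega
      · linarith
    have hz' : (j0 : k) * i1 - j1 * i0 = j0 + i1 - 1 := by exact_mod_cast congrArg (Int.cast : ℤ → k) hz
    rw [hz'] at hsum
    exact mul_ne_zero (mul_ne_zero hf hg) (hN _ _ _ _ hi1 hf hg) hsum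
  · intro r hr hr'
    by_contra hc
    have h1 : f i0 r.1 ≠ 0 := by intro h; simp [h] at hc
    have h2 : g i1 r.2 ≠ 0 := by intro h; simp [h] at hc
    have a1 := hF _ _ h1
    have a2 := hG _ _ h2
    have hr2 := Finset.HasAntidiagonal.mem_antidiagonal.1 hr
    apply hr'
    have hrz : (r.1 : ℤ) + r.2 = j0 + j1 := by exact_mod_cast hr2
    have b1 : n * i0 = m * ((r.1 : ℤ) - 1) := by nlinarith
    have b2 : n * ((i1 : ℤ) - 1) = m * (r.2 : ℤ) := by nlinarith
    have c1 := hmax0 _ _ h1 b1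
    have c2 := hmax1 _ _ h2 b2
    ext <;> simp <;> omega
  · intro h; exact (h (by simp)).elim
  · intro p hp hp'
    apply Finset.sum_eq_zero
    intro r hr
    by_contra hc
    have h1 : f p.1 r.1 ≠ 0 := by intro h; simp [h] at hc
    have h2 : g p.2 r.2 ≠ 0 := by intro h; simp [h] at hc
    have a1 := hF _ _ h1
    have a2 := hG _ _ h2
    have hr2 := Finset.HasAntidiagonal.mem_antidiagonal.1 hr
    have hp2 := Finset.HasAntidiagonal.mem_antidiagonal.1 hp
    have hrz : (r.1 : ℤ) + r.2 = j0 + j1 := by exact_mod_cast hr2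
    have hpz : (p.1 : ℤ) + p.2 = i0 + i1 := by exact_mod_cast hp2
    have t : n * (p.1 : ℤ) + n * ((p.2 : ℤ) - 1) = m * ((r.1 : ℤ) - 1) + m * r.2 := by
      linear_combination n * hpz + hw0 + hw1 - m * hrz
    have b1 : n * p.1 = m * ((r.1 : ℤ) - 1) := by linarith
    have b2 : n * ((p.2 : ℤ) - 1) = m * (r.2 : ℤ) := by linarith
    have c1 := hmax0 _ _ h1 b1
    have c2 := hmax1 _ _ h2 b2
    have d1 : r.1 = j0 := by omega
    have d2 : n * ((p.1 : ℤ) - i0) = 0 := by rw [d1] at b1; linear_combination b1 - hw0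
    apply hp'
    rcases mul_eq_zero.1 d2 with h | h
    · omega
    · ext <;> simp <;> omega
  · intro h; exact (h (by simp)).elim

theorem pp_bound {R : Type} [CommRing R] (F : R[X][X]) : ∃ M : ℕ, ∀ i j, (F.coeff i).coeff j ≠ 0 → i < M ∧ j < M := by
  refine ⟨max (F.natDegree + 1) ((F.support.sup fun i => (F.coeff i).natDegree) + 1), fun i j h => ?_⟩
  have hi : F.coeff i ≠ 0 := by intro h0; simp [h0] at h
  have h1 := le_natDegree_of_ne_zero hi
  have h2 := le_natDegree_of_ne_zero h
  have h3 : (F.coeff i).natDegree ≤ (F.support.sup fun i => (F.coeff i).natDegree) :=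
    Finset.le_sup (f := fun i => (F.coeff i).natDegree) (mem_support_iff.2 hi)
  constructor
  · exact lt_max_of_lt_left (by omega)
  · exact lt_max_of_lt_right (by omega)

theorem euler_coeff (H : k[X][X]) (i j : ℕ) :
    ((X * derivative H).coeff i).coeff j = (H.coeff i).coeff j * i := by
  rcases i with _ | i
  · simp
  · rw [coeff_X_mul, coeff_derivative, show ((i : k[X]) + 1) = C ((i : k) + 1) by simp, coeff_mul_C]
    push_cast; rfl

theorem euler_coeff' (H : k[X][X]) (i j : ℕ) :
    ((C X * dT k H).coeff i).coeff j = (H.coeff i).coeff j * j := by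
  rw [coeff_C_mul, dT_coeff]
  rcases j with _ | j
  · simp
  · rw [coeff_X_mul, coeff_derivative]
    push_cast; rfl

theorem coeff_mul2 (F G : k[X][X]) (a b : ℕ) : ((F * G).coeff a).coeff b =
    ∑ p ∈ Finset.HasAntidiagonal.antidiagonal a, ∑ r ∈ Finset.HasAntidiagonal.antidiagonal b,
      (F.coeff p.1).coeff r.1 * (G.coeff p.2).coeff r.2 := by
  rw [coeff_mul, finsetSum_coeff]
  exact Finset.sum_congr rfl fun p _ => coeff_mul _ _ _

theorem jac_main (l N : ℕ) [Fact l.Prime] [CharP k l] (hNl : 2 * N + 5 ≤ l) (F G : k[X][X]) (hJ : jac F G = 1)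
    (hF0 : ∀ i, (F.coeff i).coeff 0 = 0) (hFN : ∀ i j, (F.coeff i).coeff j ≠ 0 → j ≤ N)
    (hGN : ∀ i j, (G.coeff i).coeff j ≠ 0 → i ≤ N) :
    (∀ i j, 1 ≤ i → (F.coeff i).coeff j = 0) ∧ (∀ i j, 2 ≤ i → (G.coeff i).coeff j = 0) := by
  have hcast : ∀ n : ℕ, 0 < n → n < l → (n : k) ≠ 0 := fun n h h' => (unit_cast l n h h').ne_zero
  -- restriction to y = 0
  have h0 : ((dT k F).map (evalRingHom 0)) * ((derivative G).map (evalRingHom 0)) = 1 := by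
    have h := congrArg (Polynomial.map (evalRingHom (0 : k))) hJ
    have hz : (derivative F).map (evalRingHom (0 : k)) = 0 := by
      ext i
      rw [coeff_map, coeff_derivative]
      simp [← coeff_zero_eq_eval_zero, hF0]
    rw [jac, Polynomial.map_sub, Polynomial.map_mul, Polynomial.map_mul, hz, mul_zero, sub_zero,
      Polynomial.map_one] at h
    exact h
  have hu1 := IsUnit.of_mul_eq_one _ h0
  have hu2 := IsUnit.of_mul_eq_one _ ((mul_comm _ _).trans h0)
  rw [Polynomial.isUnit_iff] at hu1 hu2
  obtain ⟨c, hc, hcF⟩ := hu1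
  obtain ⟨d, hd, hdG⟩ := hu2
  have hFi : ∀ i, (F.coeff i).coeff 1 = (C c : k[X]).coeff i := by
    intro i
    rw [hcF, coeff_map, dT_coeff]
    simp [← coeff_zero_eq_eval_zero, coeff_derivative]
  have hGi : ∀ i : ℕ, (G.coeff (i+1)).coeff 0 * (i + 1) = (C d : k[X]).coeff i := by
    intro i
    rw [hdG, coeff_map, coeff_derivative]
    simp [← coeff_zero_eq_eval_zero]
  obtain ⟨M1, hM1⟩ := pp_bound F
  obtain ⟨M2, hM2⟩ := pp_bound G
  refine polygon (fun i j => (F.coeff i).coeff j) (fun i j => (G.coeff i).coeff j) (max M1 M2)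
    (fun i j h => ⟨lt_max_of_lt_left (hM1 i j h).1, lt_max_of_lt_left (hM1 i j h).2⟩)
    (fun i j h => ⟨lt_max_of_lt_right (hM2 i j h).1, lt_max_of_lt_right (hM2 i j h).2⟩)
    hF0 ?_ ?_ ?_ ?_ ?_ ?_
  · intro i hi
    rw [hFi, coeff_C, if_neg (by omega)]
  · rw [hFi, coeff_C, if_pos rfl]; exact hc.ne_zero
  · have := hGi 0
    rw [coeff_C, if_pos rfl] at this
    intro h
    rw [h] at this
    exact hd.ne_zero (by simpa using this.symm)
  · intro i hi
    by_contra h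
    have h2 := hGN _ _ h
    have := hGi (i - 1)
    rw [coeff_C, if_neg (by omega), Nat.sub_add_cancel (by omega)] at this
    rcases mul_eq_zero.1 this with h3 | h3
    · exact h h3
    · apply hcast i (by omega) (by omega)
      rw [← h3, ← Nat.cast_succ]; congr 1; omega
  · intro a b hab
    have e : (C X * dT k F) * (X * derivative G) - (C X * dT k G) * (X * derivative F) = X * C X := by
      have : jac F G = 1 := hJ
      rw [jac] at this
      linear_combination (X * C X) * this
    rw [mul_comm (C X * dT k G)] at e
    have e2 := congrArg (fun H => (H.coeff a).coeff b) e
    simp only [coeff_sub, coeff_mul2 (C X * dT k F), coeff_mul2 (X * derivative F), euler_coeff, euler_coeff', ← Finset.sum_sub_distrib] at e2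
    rw [mul_comm (X : k[X][X]) (C X), coeff_C_mul, coeff_X] at e2
    have e3 : (X * if 1 = a then (1 : k[X]) else 0).coeff b = 0 := by
      split_ifs with h1
      · rw [mul_one, coeff_X, if_neg]; omega
      · simp
    rw [e3] at e2
    rw [← e2]
    refine Finset.sum_congr rfl fun p _ => Finset.sum_congr rfl fun r _ => by ring
  · intro i j i' j' hi' h h'
    have h1 := hFN _ _ h
    have h2 := hGN _ _ h'
    have h3 : j ≠ 0 := by rintro rfl; exact h (hF0 i)
    have := hcast (j + i' - 1) (by omega) (by omega)
    rw [Nat.cast_sub (by omega)] at this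
    push_cast at this
    exact this

end polygon
end

section
section modl

theorem sig_nrm_pow {R : Type} [CommRing R] (l : ℕ) (hl : 0 < l) (F : R[X][X]) (n : ℕ) :
    (sig R (nrm (Wx R ^ l) (Wy R ^ l) F)).coeff (l * n) = expand R l (F.coeff n) := by
  induction F using pp_ind with
  | hadd f g hf hg => simp only [map_add, hf, hg, coeff_add]
  | hmon i j a =>
    rw [nrm_mon, ← pow_mul, ← pow_mul, map_smul, sig_mon]
    simp only [smul_monomial, smul_eq_mul, mul_one, coeff_monomial, Nat.mul_right_inj hl.ne']
    split_ifs
    · rw [expand_monomial, mul_comm]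
    · simp

theorem dT_map {R R' : Type} [CommRing R] [CommRing R'] (π : R →+* R') (F : R[X][X]) :
    dT R' (F.map (mapRingHom π)) = (dT R F).map (mapRingHom π) := by
  ext i j
  rw [dT_coeff, coeff_map, coeff_map, dT_coeff, coe_mapRingHom, derivative_map]

theorem jac_map {R R' : Type} [CommRing R] [CommRing R'] (π : R →+* R') (F G : R[X][X]) :
    jac (F.map (mapRingHom π)) (G.map (mapRingHom π)) = (jac F G).map (mapRingHom π) := by
  simp only [jac, dT_map, derivative_map, Polynomial.map_sub, Polynomial.map_mul]

theorem wMap_comp {R R' R'' : Type} [CommRing R] [CommRing R'] [CommRing R''] (f : R →+* R')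
    (g : R' →+* R'') (w : Weyl R) : wMap g (wMap f w) = wMap (g.comp f) w := by
  apply cf_ext
  intro i j
  simp only [cf, sig_wMap_coeff, RingHom.comp_apply]

theorem cf_wMap {R R' : Type} [CommRing R] [CommRing R'] (f : R →+* R') (w : Weyl R) (i j : ℕ) :
    cf (wMap f w) i j = f (cf w i j) := sig_wMap_coeff f w i j

theorem bet_nrm_cf {k : Type} [Field k] (l : ℕ) [Fact l.Prime] [CharP k l] (F : k[X][X]) (i : ℕ) :
    cf (bet k (nrm (Wx k ^ l) (Wy k ^ l) F)).unop (l * i) 0 = (F.coeff i).coeff 0 := by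
  have hl : l.Prime := Fact.out
  have hcen := central_pow l (Weyl_rel k)
  unfold cf
  induction F using pp_ind with
  | hadd f g hf hg => simp only [map_add, MulOpposite.unop_add, hf, hg, coeff_add]
  | hmon m n a =>
    have h1 : (bet k (nrm (Wx k ^ l) (Wy k ^ l) (monomial m (monomial n a)))).unop =
        (a * (-1) ^ (l * n)) • (Wx k ^ (l * m) * Wy k ^ (l * n)) := by
      rw [nrm_mon]
      simp only [map_smul, map_mul, map_pow, bet_x, bet_y, MulOpposite.unop_smul,
        MulOpposite.unop_mul, MulOpposite.unop_pow, MulOpposite.unop_op, ← pow_mul]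
      have h2 : (- Wy k) ^ (l * n) = ((-1 : k) ^ (l * n)) • Wy k ^ (l * n) := by
        rw [show - Wy k = (-1 : k) • Wy k from (neg_one_smul k (Wy k)).symm, _root_.smul_pow]
      have h3 : Wy k ^ (l * n) * Wx k ^ (l * m) = Wx k ^ (l * m) * Wy k ^ (l * n) := by
        rw [pow_mul (Wy k)]
        exact (Commute.pow_left (hcen _) n).eq
      rw [h2, smul_mul_assoc, smul_smul, h3]
    rw [h1, map_smul, sig_mon]
    simp only [smul_monomial, smul_eq_mul, mul_one, coeff_monomial, Nat.mul_right_inj hl.ne_zero]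
    split_ifs
    · rcases n with _ | n
      · simp
      · simp [coeff_monomial, hl.ne_zero]
    · simp

theorem odd_neg_pow_aux {A : Type} [Ring A] (x : A) (n : ℕ) (h : Odd n) : (-x) ^ n = - x ^ n :=
  h.neg_pow x

theorem charP_aux {R : Type} [CommRing R] [Nontrivial R] (l : ℕ) [Fact l.Prime] (h : (l : R) = 0) :
    CharP R l := by
  have hl : l.Prime := Fact.out
  have h1 : ringChar R ∣ l := ringChar.dvd h
  rcases (Nat.dvd_prime hl).1 h1 with h2 | h2
  · exact absurd h2 CharP.ringChar_ne_one
  · exact ringChar.of_eq h2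

theorem mod_l {R k : Type} [CommRing R] [IsDomain R] [Field k] (l N : ℕ) [Fact l.Prime] [CharP k l]
    (hlR : (l : R) ≠ 0) (hNl : 2 * N + 5 ≤ l) (π : R →+* k) {D S : Weyl R} (h : D * S = S * D + 1)
    (hβ : bet R D = MulOpposite.op (-D)) (hDN : (tdeg N (sig R D)))
    (hSN : (sig R S).natDegree ≤ N) :
    (∀ i j, 1 ≤ i → π (cf D i j) = 0) ∧ (∀ i j, 2 ≤ i → π (cf S i j) = 0) := by
  have hl : l.Prime := Fact.out
  have hlk : (l : k) = 0 := CharP.cast_eq_zero k l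
  let I2 : Ideal R := Ideal.span {(l : R) ^ 2}
  let I1 : Ideal R := Ideal.span {(l : R)}
  have hI : I2 ≤ I1 := by
    rw [Ideal.span_singleton_le_span_singleton]; exact dvd_pow_self _ two_ne_zero
  have hI1 : I1 ≠ ⊤ := by
    intro ht
    rw [Ideal.span_singleton_eq_top] at ht
    have := ht.map π
    rw [map_natCast, hlk] at this
    exact not_isUnit_zero this
  have : Nontrivial (R ⧸ I1) := Ideal.Quotient.nontrivial_iff.2 hI1
  have hl1 : (l : R ⧸ I1) = 0 := by
    rw [← map_natCast (Ideal.Quotient.mk I1), Ideal.Quotient.eq_zero_iff_mem]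
    exact Ideal.mem_span_singleton_self _
  have : CharP (R ⧸ I1) l := charP_aux l hl1
  have hl2 : (l : R ⧸ I2) ^ 2 = 0 := by
    rw [← map_natCast (Ideal.Quotient.mk I2), ← map_pow, Ideal.Quotient.eq_zero_iff_mem]
    exact Ideal.mem_span_singleton_self _
  let φ : R ⧸ I2 →+* R ⧸ I1 := Ideal.Quotient.factor hI
  have hφ : ∀ r, φ r = 0 → ∃ s, r = l * s := by
    intro r hr
    obtain ⟨r, rfl⟩ := Ideal.Quotient.mk_surjective r
    have hr' : Ideal.Quotient.mk I1 r = 0 := hr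
    rw [Ideal.Quotient.eq_zero_iff_mem, Ideal.mem_span_singleton'] at hr'
    obtain ⟨s, rfl⟩ := hr'
    exact ⟨Ideal.Quotient.mk I2 s, by rw [map_mul, map_natCast, mul_comm]⟩
  let μ := Ideal.Quotient.mk I2
  let π2 : R ⧸ I2 →+* k := Ideal.Quotient.lift I2 π (by
    intro a ha
    obtain ⟨s, rfl⟩ := Ideal.mem_span_singleton'.1 ha
    rw [map_mul, map_pow, map_natCast, hlk]; simp)
  have hπ2 : π2.comp μ = π := RingHom.ext fun r => by simp [π2, μ]
  have h2 : wMap μ D * wMap μ S = wMap μ S * wMap μ D + 1 := by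
    rw [← map_mul, h, map_add, map_mul, map_one]
  obtain ⟨F, G, a, b, hF, hG, hJ⟩ := jac_lift l φ hφ hl2 h2
  set Fk := F.map (mapRingHom π2) with hFk
  set Gk := G.map (mapRingHom π2) with hGk
  have hJk : jac Fk Gk = 1 := by
    rw [hFk, hGk, jac_map, ← sub_eq_zero]
    have : (jac F G).map (mapRingHom π2) - 1 = (jac F G - 1).map (mapRingHom π2) := by
      rw [Polynomial.map_sub, Polynomial.map_one]
    rw [this]
    ext i j
    rw [coeff_map, coe_mapRingHom, coeff_map, coeff_zero, coeff_zero]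
    have h3 := congrArg (fun H => (H.coeff i).coeff j) hJ
    simp only [coeff_smul, coeff_zero] at h3
    generalize ((jac F G - 1).coeff i).coeff j = c at h3
    obtain ⟨r, rfl⟩ := Ideal.Quotient.mk_surjective c
    rw [smul_eq_mul, ← map_natCast (Ideal.Quotient.mk I2), ← map_mul, Ideal.Quotient.eq_zero_iff_mem,
      Ideal.mem_span_singleton'] at h3
    obtain ⟨s, hs⟩ := h3
    have h4 : (l : R) * ((((l - 1).factorial : ℕ) : R) * r) = l * (l * s) := by
      rw [← Nat.mul_factorial_pred hl.ne_zero] at hs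
      push_cast at hs
      linear_combination - hs
    have h5 := mul_left_cancel₀ hlR h4
    have h6 := congrArg π h5
    rw [map_mul, map_mul, map_natCast, map_natCast, hlk, zero_mul] at h6
    have h7 : (((l - 1).factorial : ℕ) : k) ≠ 0 := by
      have h70 : ¬ l ∣ (l - 1).factorial := by
        rw [hl.dvd_factorial]
        have := hl.pos
        omega
      intro h71
      exact h70 ((CharP.cast_eq_zero_iff k l _).1 h71)
    change π2 (μ r) = 0
    rw [← RingHom.comp_apply, hπ2]
    exact (mul_eq_zero.1 h6).resolve_left h7
  have hDk : (wMap π D) ^ l = nrm (Wx k ^ l) (Wy k ^ l) Fk := by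
    have := congrArg (wMap π2) hF
    rw [map_add, wMap_smul, map_natCast, hlk, zero_smul, add_zero, wMap_nrm, map_pow, map_pow, map_pow,
      wMap_x, wMap_y, wMap_comp, hπ2] at this
    exact this
  have hSk : (wMap π S) ^ l = nrm (Wx k ^ l) (Wy k ^ l) Gk := by
    have := congrArg (wMap π2) hG
    rw [map_add, wMap_smul, map_natCast, hlk, zero_smul, add_zero, wMap_nrm, map_pow, map_pow, map_pow,
      wMap_x, wMap_y, wMap_comp, hπ2] at this
    exact this
  have hodd : Odd l := hl.odd_of_ne_two (by omega)
  have hF0 : ∀ i, (Fk.coeff i).coeff 0 = 0 := by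
    intro i
    have h3 := bet_nrm_cf l Fk i
    rw [← hDk, map_pow, wMap_bet, hβ, ← MulOpposite.op_pow, MulOpposite.unop_op, MulOpposite.unop_op, map_neg] at h3
    have e := odd_neg_pow_aux (wMap π D) l hodd
    rw [hDk] at e
    replace h3 := (congrArg (fun w => cf w (l * i) 0) e).symm.trans h3
    have h4 : cf (-(nrm (Wx k ^ l) (Wy k ^ l) Fk)) (l * i) 0 = - (Fk.coeff i).coeff 0 := by
      rw [← sig_nrm_pow_coeff l hl.pos Fk i 0]
      simp [cf]
    rw [h4] at h3
    have h5 : (2 : k) * (Fk.coeff i).coeff 0 = 0 := by linear_combination -h3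
    have h6 := unit_cast (B := k) l 2 (by omega) (by omega)
    exact (mul_eq_zero.1 h5).resolve_left (by exact_mod_cast h6.ne_zero)
  have htD : tdeg N (sig k (wMap π D)) := by
    intro i
    rw [sig_wMap, coeff_map]
    exact natDegree_map_le.trans (hDN i)
  have hnS : (sig k (wMap π S)).natDegree ≤ N := by
    rw [sig_wMap]; exact natDegree_map_le.trans hSN
  have key := jac_main l N hNl Fk Gk hJk hF0 (by
      intro i j hij
      rw [← sig_nrm_pow_coeff l hl.pos, ← hDk] at hij
      have := (le_natDegree_of_ne_zero hij).trans (tdeg_pow _ N htD l _)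
      exact Nat.le_of_mul_le_mul_left this hl.pos) (by
      intro i j hij
      rw [← sig_nrm_pow_coeff l hl.pos, ← hSk, cf] at hij
      have h0 : (sig k (wMap π S ^ l)).coeff (l * i) ≠ 0 := by intro h0; rw [h0] at hij; simp at hij
      have := (le_natDegree_of_ne_zero h0).trans (sig_lead_pow _ N hnS l).1
      exact Nat.le_of_mul_le_mul_left this hl.pos)
  have lead : ∀ (w : Weyl k) (H : k[X][X]) (b : ℕ), w ^ l = nrm (Wx k ^ l) (Wy k ^ l) H →
      (∀ i j, b ≤ i → (H.coeff i).coeff j = 0) → ∀ i j, b ≤ i → cf w i j = 0 := by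
    intro w H b hw hH i j hi
    by_contra hc
    have h0 : (sig k w).coeff i ≠ 0 := by intro h0; rw [cf, h0] at hc; simp at hc
    have h1 := le_natDegree_of_ne_zero h0
    have h2 := (sig_lead_pow w _ le_rfl l).2
    rw [hw, sig_nrm_pow l hl.pos] at h2
    have h3 : H.coeff (sig k w).natDegree = 0 := by
      ext j; rw [coeff_zero]; exact hH _ j (by omega)
    rw [h3, map_zero] at h2
    have h4 := eq_zero_of_pow_eq_zero h2.symm
    have h5 : sig k w = 0 := leadingCoeff_eq_zero.1 h4
    rw [h5] at h0; simp at h0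
  constructor
  · intro i j hi
    rw [← cf_wMap]; exact lead _ Fk 1 hDk key.1 i j hi
  · intro i j hi
    rw [← cf_wMap]; exact lead _ Gk 2 hSk key.2 i j hi

end modl
end

section
theorem sig_x_aeval {R : Type} [CommRing R] (i : ℕ) (g : R[X]) :
    sig R (Wx R ^ i * aeval (Wy R) g) = monomial i g := by
  induction g using Polynomial.induction_on' with
  | add p q hp hq => rw [map_add (aeval (Wy R)), mul_add, map_add, hp, hq, map_add]
  | monomial n a =>
    rw [aeval_monomial, ← Algebra.smul_def, mul_smul_comm, map_smul, sig_mon, smul_monomial,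
      smul_monomial, smul_eq_mul, mul_one]

theorem two_term {R : Type} [CommRing R] (w : Weyl R) (h : ∀ i j, 2 ≤ i → cf w i j = 0) :
    w = aeval (Wy R) ((sig R w).coeff 0) + Wx R * aeval (Wy R) ((sig R w).coeff 1) := by
  apply sig_inj
  have h0 := sig_x_aeval (R := R) 0 ((sig R w).coeff 0)
  have h1 := sig_x_aeval (R := R) 1 ((sig R w).coeff 1)
  rw [pow_zero, one_mul] at h0
  rw [pow_one] at h1
  rw [map_add, h0, h1]
  ext i j
  rcases i with _ | _ | i
  · simp [coeff_monomial]
  · simp [coeff_monomial]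
  · have := h (i + 2) j (by omega)
    rw [cf] at this
    rw [this]; simp [coeff_monomial]

theorem final_aux {A K : Type} [Field K] [CharZero K] [Ring A] [Algebra K A] {p q D S : A}
    (hpq : p * q = q * p + 1) (h : D * S = S * D + 1) (d s0 s1 : K[X]) (hD : D = aeval p d)
    (hS : S = aeval p s0 + q * aeval p s1) (hinj : Function.Injective (aeval (R := K) p)) :
    p ∈ Algebra.adjoin K {D, S} ∧ q ∈ Algebra.adjoin K {D, S} := by
  have h1 := aeval_comm hpq d
  have h2 : aeval p (derivative d * s1) = aeval p (1 : K[X]) := by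
    have e1 : D * S = S * D + aeval p (derivative d) * aeval p s1 := by
      rw [hD, hS, mul_add, ← mul_assoc, h1, add_mul, add_mul, mul_assoc q, mul_assoc q, ← map_mul,
        ← map_mul, ← map_mul, ← map_mul, ← map_mul, mul_comm d s0, mul_comm d s1, add_assoc]
    rw [h] at e1
    rw [map_mul, map_one]
    exact (add_left_cancel e1).symm
  have h3 := hinj h2
  have hu1 : IsUnit (derivative d) := IsUnit.of_mul_eq_one _ h3
  have hu2 : IsUnit s1 := IsUnit.of_mul_eq_one _ ((mul_comm _ _).trans h3)
  obtain ⟨a, ha, hda⟩ := Polynomial.isUnit_iff.1 hu1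
  obtain ⟨b, hb, hsb⟩ := Polynomial.isUnit_iff.1 hu2
  have hd : d = C a * X + C (d.coeff 0) := by
    ext n
    rcases n with _ | n
    · simp
    · have h4 := coeff_derivative d n
      rw [← hda] at h4
      have h5 : (n : K) + 1 ≠ 0 := by exact_mod_cast Nat.succ_ne_zero n
      rcases n with _ | n
      · simp at h4; simp [h4]
      · rw [coeff_C_succ] at h4
        have := (mul_eq_zero.1 h4.symm).resolve_right h5
        rw [this]; simp [coeff_X, coeff_C]
  have hDm : D ∈ Algebra.adjoin K {D, S} := Algebra.subset_adjoin (by simp)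
  have hSm : S ∈ Algebra.adjoin K {D, S} := Algebra.subset_adjoin (by simp)
  have hp : p ∈ Algebra.adjoin K {D, S} := by
    have : p = a⁻¹ • (D - algebraMap K A (d.coeff 0)) := by
      conv_rhs => rw [hD]
      nth_rewrite 1 [hd]
      rw [map_add, map_mul, aeval_C, aeval_X, aeval_C, add_sub_cancel_right, ← Algebra.smul_def,
        smul_smul, inv_mul_cancel₀ ha.ne_zero, one_smul]
    have h6 := Subalgebra.smul_mem _ (sub_mem hDm (Subalgebra.algebraMap_mem _ (d.coeff 0))) a⁻¹
    rwa [← this] at h6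
  refine ⟨hp, ?_⟩
  have hs0 : aeval p s0 ∈ Algebra.adjoin K {D, S} := by
    have := Polynomial.aeval_mem_adjoin_singleton K p (p := s0)
    exact (Algebra.adjoin_le (by simpa using hp)) this
  have : q = b⁻¹ • (S - aeval p s0) := by
    conv_rhs => rw [hS]
    rw [add_sub_cancel_left, ← hsb, aeval_C, ← Algebra.commutes, ← Algebra.smul_def,
        smul_smul, inv_mul_cancel₀ hb.ne_zero, one_smul]
  have h6 := Subalgebra.smul_mem _ (sub_mem hSm hs0) b⁻¹
  rwa [← this] at h6

theorem jac_int : IsJacobsonRing ℤ := by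
  rw [isJacobsonRing_iff_prime_eq]
  intro P hP
  by_cases h : P = ⊥
  · subst h
    rw [eq_bot_iff]
    intro x hx
    rw [Ideal.mem_jacobson_bot] at hx
    have h1 := Int.isUnit_iff.1 (hx x)
    rw [Ideal.mem_bot]
    rcases h1 with h1 | h1
    · nlinarith
    · nlinarith
  · have := hP.isMaximal h
    exact Ideal.jacobson_eq_self_of_isMaximal

theorem finite_res' (k : Type) [Field k] (hk : (Int.castRingHom k).FiniteType) :
    ∃ l : ℕ, l.Prime ∧ CharP k l := by
  have h2 : Int.castRingHom k = algebraMap ℤ k := Subsingleton.elim _ _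
  rw [h2, RingHom.finiteType_algebraMap] at hk
  obtain ⟨l, hl⟩ := CharP.exists k
  rcases CharP.char_is_prime_or_zero k l with h | h
  · exact ⟨l, h, hl⟩
  · exfalso
    subst h
    have := CharP.charP_to_charZero k
    have := jac_int
    have : Module.Finite ℤ k := finite_of_finite_type_of_isJacobsonRing ℤ k
    have h1 : Function.Injective (algebraMap ℤ k) := by
      intro a b hab; simpa using hab
    have h2 := isField_of_isIntegral_of_isField h1 (Field.toIsField k)
    exact Int.not_isField h2

theorem finite_res (R : Type) [CommRing R] [Nontrivial R] (hR : (Int.castRingHom R).FiniteType) :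
    ∃ (k : Type) (_ : Field k) (_ : R →+* k) (l : ℕ), l.Prime ∧ CharP k l := by
  obtain ⟨m, hm⟩ := Ideal.exists_maximal R
  let _ : Field (R ⧸ m) := Ideal.Quotient.field m
  have h1 : ((Ideal.Quotient.mk m).comp (Int.castRingHom R)).FiniteType :=
    RingHom.FiniteType.comp_surjective hR Ideal.Quotient.mk_surjective
  have h2 : (Ideal.Quotient.mk m).comp (Int.castRingHom R) = Int.castRingHom (R ⧸ m) := Subsingleton.elim _ _
  rw [h2] at h1
  exact ⟨R ⧸ m, inferInstance, Ideal.Quotient.mk m, finite_res' (R ⧸ m) h1⟩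

/-- key vanishing statement -/
theorem vanish {K : Type} [Field K] [CharZero K] {D S : Weyl K} (h : D * S = S * D + 1)
    (hβ : bet K D = MulOpposite.op (-D)) (c : K) (hc : c ≠ 0)
    (hc2 : ∃ i j, (1 ≤ i ∧ cf D i j = c) ∨ (2 ≤ i ∧ cf S i j = c)) : False := by
  classical
  obtain ⟨M1, hM1⟩ := pp_bound (sig K D)
  obtain ⟨M2, hM2⟩ := pp_bound (sig K S)
  set N := M1 + M2 with hN
  let E : Finset (ℕ × ℕ) := Finset.range N ×ˢ Finset.range N
  let s : Finset K := (E.image fun x => cf D x.1 x.2) ∪ (E.image fun x => cf S x.1 x.2) ∪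
    {c⁻¹, (((2 * N + 5).factorial : ℕ) : K)⁻¹}
  let R : Subalgebra ℤ K := Algebra.adjoin ℤ (s : Set K)
  have hsR : ∀ x ∈ s, x ∈ R := fun x hx => Algebra.subset_adjoin hx
  have hD : ∀ i j, cf D i j ∈ R := by
    intro i j
    by_cases h0 : cf D i j = 0
    · rw [h0]; exact zero_mem _
    · have := hM1 i j h0
      apply hsR
      simp only [s, Finset.mem_union, Finset.mem_image]
      exact Or.inl (Or.inl ⟨(i, j), by simp [E]; omega, rfl⟩)
  have hS : ∀ i j, cf S i j ∈ R := by
    intro i j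
    by_cases h0 : cf S i j = 0
    · rw [h0]; exact zero_mem _
    · have := hM2 i j h0
      apply hsR
      simp only [s, Finset.mem_union, Finset.mem_image]
      exact Or.inl (Or.inr ⟨(i, j), by simp [E]; omega, rfl⟩)
  have hcR : c ∈ R := by
    obtain ⟨i, j, h1 | h1⟩ := hc2
    · rw [← h1.2]; exact hD i j
    · rw [← h1.2]; exact hS i j
  have hciR : c⁻¹ ∈ R := hsR _ (by simp [s])
  have hfiR : (((2 * N + 5).factorial : ℕ) : K)⁻¹ ∈ R := hsR _ (by simp [s])
  let φ : R →+* K := R.val.toRingHom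
  have hφ : Function.Injective φ := Subtype.val_injective
  have hran : ∀ x : K, x ∈ R → x ∈ φ.range := fun x hx => ⟨⟨x, hx⟩, rfl⟩
  obtain ⟨D', hD'⟩ := wMap_surj_of φ D (fun i j => hran _ (hD i j))
  obtain ⟨S', hS'⟩ := wMap_surj_of φ S (fun i j => hran _ (hS i j))
  have h' : D' * S' = S' * D' + 1 := by
    apply wMap_inj φ hφ
    rw [map_mul, map_add, map_mul, map_one, hD', hS', h]
  have hβ' : bet R D' = MulOpposite.op (-D') := by
    apply MulOpposite.unop_injective
    apply wMap_inj φ hφ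
    apply MulOpposite.op_injective
    rw [← wMap_bet, hD', hβ, MulOpposite.unop_op, map_neg, hD']
  have hft : (Int.castRingHom R).FiniteType := by
    have h1 : Algebra.FiniteType ℤ R := (Subalgebra.fg_iff_finiteType R).1 (Subalgebra.fg_adjoin_finset s)
    have h2 : Int.castRingHom R = algebraMap ℤ R := Subsingleton.elim _ _
    rw [h2, RingHom.finiteType_algebraMap]
    exact h1
  obtain ⟨k, _, π, l, hl, hch⟩ := finite_res R hft
  have : Fact l.Prime := ⟨hl⟩
  have hun : ∀ x : R, x.1⁻¹ ∈ R → x.1 ≠ 0 → π x ≠ 0 := by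
    intro x hx hx0
    have : IsUnit x := IsUnit.of_mul_eq_one ⟨x.1⁻¹, hx⟩ (Subtype.ext (mul_inv_cancel₀ hx0))
    exact (this.map π).ne_zero
  have hlN : 2 * N + 5 ≤ l := by
    by_contra hlt
    have h1 := hun (((2 * N + 5).factorial : ℕ) : R) (by simpa using hfiR)
      (by simpa using Nat.factorial_ne_zero (2 * N + 5))
    rw [map_natCast] at h1
    exact h1 ((CharP.cast_eq_zero_iff k l _).2 (hl.dvd_factorial.2 (by omega)))
  have hlR : (l : R) ≠ 0 := by
    intro h0
    have h1 := congrArg φ h0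
    rw [map_natCast, map_zero] at h1
    exact hl.ne_zero (by exact_mod_cast h1)
  have hDc : ∀ i j, φ (cf D' i j) = cf D i j := fun i j => by rw [← cf_wMap, hD']
  have hSc : ∀ i j, φ (cf S' i j) = cf S i j := fun i j => by rw [← cf_wMap, hS']
  have key := mod_l l N hlR hlN π h' hβ' (by
    intro i
    rw [natDegree_le_iff_coeff_eq_zero]
    intro j hj
    by_contra h0
    have h1 : cf D i j ≠ 0 := by
      rw [← hDc]
      exact fun h2 => h0 (hφ (h2.trans (map_zero φ).symm))
    have := hM1 i j h1
    omega) (by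
    rw [natDegree_le_iff_coeff_eq_zero]
    intro i hi
    refine Polynomial.ext fun j => ?_
    rw [coeff_zero]
    by_contra h0
    have h1 : cf S i j ≠ 0 := by
      rw [← hSc]
      exact fun h2 => h0 (hφ (h2.trans (map_zero φ).symm))
    have := hM2 i j h1
    omega)
  obtain ⟨i, j, h1 | h1⟩ := hc2
  · have h2 : (cf D' i j).1 = c := (hDc i j).trans h1.2
    exact hun (cf D' i j) (by rwa [h2]) (by rwa [h2]) (key.1 i j h1.1)
  · have h2 : (cf S' i j).1 = c := (hSc i j).trans h1.2
    exact hun (cf S' i j) (by rwa [h2]) (by rwa [h2]) (key.2 i j h1.1)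

theorem main_thm {K : Type} [Field K] [CharZero K] {D S : Weyl K} (h : D * S = S * D + 1)
    (hβ : bet K D = MulOpposite.op (-D)) : Algebra.adjoin K {D, S} = ⊤ := by
  have h1 : ∀ i j, 1 ≤ i → cf D i j = 0 := by
    intro i j hi
    by_contra hc
    exact vanish h hβ _ hc ⟨i, j, Or.inl ⟨hi, rfl⟩⟩
  have h2 : ∀ i j, 2 ≤ i → cf S i j = 0 := by
    intro i j hi
    by_contra hc
    exact vanish h hβ _ hc ⟨i, j, Or.inr ⟨hi, rfl⟩⟩
  have hD := two_term D (fun i j hi => h1 i j (by omega))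
  have hS := two_term S h2
  have hD1 : (sig K D).coeff 1 = 0 := by
    ext j; exact h1 1 j le_rfl
  rw [hD1, map_zero (aeval (Wy K)), mul_zero, add_zero] at hD
  have hinj : Function.Injective (aeval (R := K) (Wy K)) := by
    intro a b hab
    have ha := sig_x_aeval (R := K) 0 a
    have hb := sig_x_aeval (R := K) 0 b
    rw [hab, hb] at ha
    exact (monomial_injective 0 ha).symm
  obtain ⟨hp, hq⟩ := final_aux (Weyl_rel K) h _ _ _ hD hS hinj
  rw [eq_top_iff, ← weyl_adjoin K]
  apply Algebra.adjoin_le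
  rintro x (rfl | rfl)
  · exact hq
  · exact hp
end

section
theorem gen_theta {K A : Type} [Field K] [Ring A] [Algebra K A] (c : K) (hc : c + c = 1) {x y : A}
    (h : y * x = x * y + 1) : (c • x + y) * (c • x - y) = (c • x - y) * (c • x + y) + 1 := by
  simp only [add_mul, mul_sub, sub_mul, mul_add, smul_mul_assoc, mul_smul_comm, h, smul_add]
  have h1 : (c • (1 : A)) + c • 1 = 1 := by rw [← add_smul, hc, one_smul]
  nth_rewrite 3 [← h1]
  module

theorem gen_psi {K A : Type} [Field K] [Ring A] [Algebra K A] (c : K) (hc : c + c = 1) {x y : A}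
    (h : y * x = x * y + 1) : (c • (y - x)) * (x + y) = (x + y) * (c • (y - x)) + 1 := by
  simp only [add_mul, mul_sub, sub_mul, mul_add, smul_mul_assoc, mul_smul_comm, h, smul_add]
  have h1 : (c • (1 : A)) + c • 1 = 1 := by rw [← add_smul, hc, one_smul]
  nth_rewrite 3 [← h1]
  module

theorem gen_DS {K A : Type} [Field K] [Ring A] [Algebra K A] (c : K) (hc : c + c = 1) {x y : A}
    (h : y * x = x * y + 1) : (y - x) * (c • (y + x)) = (c • (y + x)) * (y - x) + 1 := by
  simp only [add_mul, mul_sub, sub_mul, mul_add, smul_mul_assoc, mul_smul_comm, h, smul_add]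
  have h1 : (c • (1 : A)) + c • 1 = 1 := by rw [← add_smul, hc, one_smul]
  nth_rewrite 3 [← h1]
  module

theorem gen_half1 {K A : Type} [Field K] [Ring A] [Algebra K A] (c : K) (hc : c + c = 1) (x y : A) :
    c • (x + y) - c • (y - x) = x := by
  have h1 : c • x + c • x = x := by rw [← add_smul, hc, one_smul]
  nth_rewrite 3 [← h1]
  module

theorem gen_half2 {K A : Type} [Field K] [Ring A] [Algebra K A] (c : K) (hc : c + c = 1) (x y : A) :
    c • (x + y) + c • (y - x) = y := by
  have h1 : c • y + c • y = y := by rw [← add_smul, hc, one_smul]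
  nth_rewrite 3 [← h1]
  module

theorem inj_aux {K : Type} [Field K] [CharZero K] (F : Weyl K →ₐ[K] Weyl K) (n : ℕ) :
    ∀ w, F w = 0 → (∀ i j, n ≤ i + j → cf w i j = 0) → ∀ i j, cf w i j = 0 := by
  induction n with
  | zero => intro w _ h i j; exact h i j (Nat.zero_le _)
  | succ n ih =>
    intro w hw h
    have h1 := ih (w * Wx K - Wx K * w) (by rw [map_sub, map_mul, map_mul, hw]; simp) (by
      intro i j hij
      rw [cf_comm_x, h i (j + 1) (by omega), zero_mul])
    have h2 := ih (Wy K * w - w * Wy K) (by rw [map_sub, map_mul, map_mul, hw]; simp) (by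
      intro i j hij
      rw [cf_comm_y, h (i + 1) j (by omega), zero_mul])
    have h3 : ∀ i j, cf w i (j + 1) = 0 := by
      intro i j
      have := h1 i j
      rw [cf_comm_x] at this
      exact (mul_eq_zero.1 this).resolve_right (by exact_mod_cast Nat.succ_ne_zero j)
    have h4 : ∀ i j, cf w (i + 1) j = 0 := by
      intro i j
      have := h2 i j
      rw [cf_comm_y] at this
      exact (mul_eq_zero.1 this).resolve_right (by exact_mod_cast Nat.succ_ne_zero i)
    have h5 : w = (cf w 0 0) • (1 : Weyl K) := by
      apply cf_ext
      intro i j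
      have e : cf ((cf w 0 0) • (1 : Weyl K)) i j = cf w 0 0 * ((1 : K[X][X]).coeff i).coeff j := by
        rw [cf, map_smul, sig_one, coeff_smul, coeff_smul, smul_eq_mul]
      rw [e]
      rcases i with _ | i
      · rcases j with _ | j
        · simp
        · rw [h3]; simp [coeff_one]
      · rw [h4]; simp [coeff_one]
    have h6 : cf w 0 0 = 0 := by
      rw [h5, map_smul, map_one] at hw
      have h7 := congrArg (fun v => cf v 0 0) hw
      simp only [cf, map_smul, sig_one, map_zero, coeff_smul, coeff_zero] at h7
      change ((sig K w).coeff 0).coeff 0 = 0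
      simpa using h7
    intro i j
    rcases i with _ | i
    · rcases j with _ | j
      · exact h6
      · exact h3 _ _
    · exact h4 _ _

theorem endo_inj {K : Type} [Field K] [CharZero K] (F : Weyl K →ₐ[K] Weyl K) : Function.Injective F := by
  rw [injective_iff_map_eq_zero]
  intro w hw
  obtain ⟨M, hM⟩ := pp_bound (sig K w)
  apply cf_ext
  have := inj_aux F (2 * M) w hw (by
    intro i j hij
    by_contra h0
    have := hM i j h0
    omega)
  intro i j
  rw [this i j, cf, map_zero]; simp

theorem adjoin_top {K : Type} [Field K] [CharZero K] {α : Weyl K → Weyl K} (hα : IsExchange K α)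
    {P Q : Weyl K} (h : Q * P = P * Q + 1) (hP : α P = Q) (hQ : α Q = P) :
    Algebra.adjoin K {P, Q} = ⊤ := by
  obtain ⟨⟨⟨⟨ha, hs, hm, h1⟩, _⟩, _⟩, hx, hy⟩ := hα
  have h0 : α 0 = 0 := by
    have := hs 0 0
    rwa [zero_smul, zero_smul] at this
  let aα : Weyl K →ₐ[K] (Weyl K)ᵐᵒᵖ :=
    { toFun := fun w => MulOpposite.op (α w)
      map_one' := by rw [h1]; rfl
      map_mul' := fun a b => by rw [hm]; rfl
      map_zero' := by rw [h0]; rfl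
      map_add' := fun a b => by rw [ha]; rfl
      commutes' := fun r => by
        rw [Algebra.algebraMap_eq_smul_one, hs, h1, Algebra.algebraMap_eq_smul_one]; rfl }
  have haα : ∀ w, aα w = MulOpposite.op (α w) := fun _ => rfl
  let c : K := 2⁻¹
  have hc : c + c = 1 := by simp only [c]; norm_num
  let θ : Weyl K →ₐ[K] Weyl K := wLift (c • Wx K - Wy K) (c • Wx K + Wy K) (gen_theta c hc (Weyl_rel K))
  let ψ : Weyl K →ₐ[K] Weyl K := wLift (Wx K + Wy K) (c • (Wy K - Wx K)) (gen_psi c hc (Weyl_rel K))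
  have tx : θ (Wx K) = c • Wx K - Wy K := wLift_x _ _ _
  have ty : θ (Wy K) = c • Wx K + Wy K := wLift_y _ _ _
  have px : ψ (Wx K) = Wx K + Wy K := wLift_x _ _ _
  have py : ψ (Wy K) = c • (Wy K - Wx K) := wLift_y _ _ _
  have hψθ : ψ.comp θ = AlgHom.id K _ := by
    apply wHom_ext
    · rw [AlgHom.comp_apply, tx, map_sub, map_smul, px, py]
      exact gen_half1 c hc _ _
    · rw [AlgHom.comp_apply, ty, map_add, map_smul, px, py]
      exact gen_half2 c hc _ _
  have hψθ' : ∀ w, ψ (θ w) = w := fun w => DFunLike.congr_fun hψθ w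
  have hbt : (bet K).comp θ = (AlgHom.op θ).comp aα := by
    apply wHom_ext
    · rw [AlgHom.comp_apply, AlgHom.comp_apply, haα, hx, tx, map_sub, map_smul, bet_x, bet_y]
      apply MulOpposite.unop_injective
      refine Eq.trans ?_ ty.symm
      exact sub_neg_eq_add _ _
    · rw [AlgHom.comp_apply, AlgHom.comp_apply, haα, hy, ty, map_add, map_smul, bet_x, bet_y]
      apply MulOpposite.unop_injective
      refine Eq.trans ?_ tx.symm
      exact (sub_eq_add_neg _ _).symm
  have hbt' : ∀ w, bet K (θ w) = MulOpposite.op (θ (α w)) := fun w => DFunLike.congr_fun hbt w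
  have hDS := congrArg θ (gen_DS c hc h)
  rw [map_mul, map_add, map_mul, map_one] at hDS
  have hαn : ∀ w, α (-w) = - α w := fun w => by
    have := map_neg aα w
    exact MulOpposite.op_injective this
  have hαD : α (Q - P) = -(Q - P) := by
    have := map_sub aα Q P
    rw [haα, haα, haα, hP, hQ] at this
    refine (MulOpposite.op_injective this).trans (neg_sub _ _).symm
  have hβ : bet K (θ (Q - P)) = MulOpposite.op (-(θ (Q - P))) := by
    rw [hbt', hαD, map_neg]
  have key := main_thm hDS hβ
  rw [eq_top_iff]
  intro w _
  have hw : θ w ∈ Algebra.adjoin K {θ (Q - P), θ (c • (Q + P))} := by rw [key]; trivial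
  have hle : Algebra.adjoin K {θ (Q - P), θ (c • (Q + P))} ≤ (Algebra.adjoin K {P, Q}).comap ψ := by
    have hPm : P ∈ Algebra.adjoin K {P, Q} := Algebra.subset_adjoin (by simp)
    have hQm : Q ∈ Algebra.adjoin K {P, Q} := Algebra.subset_adjoin (by simp)
    apply Algebra.adjoin_le
    rintro x (rfl | rfl)
    · rw [SetLike.mem_coe, Subalgebra.mem_comap, hψθ']
      exact sub_mem hQm hPm
    · rw [SetLike.mem_coe, Subalgebra.mem_comap, hψθ']
      exact Subalgebra.smul_mem _ (add_mem hQm hPm) c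
  have := hle hw
  rwa [Subalgebra.mem_comap, hψθ'] at this
end

end

/-- restriction condition, first version: if `α` restricts to an involution
on the image `T = f(A₁)` and the involution `γ` of `T` exchanging `P` and `Q` is conjugate,
by an automorphism or anti-automorphism `g` of `T`, to the restriction of `α` to `T`
(i.e. `γ t = g⁻¹ (α (g t))` for all `t ∈ T`), then `f` is an automorphism of `A₁`. -/
theorem stmt_7 {K : Type} [Field K] [CharZero K]
    (α f : Weyl K → Weyl K) (hα : IsExchange K α) (hf : IsAlgEndo K f)
    (T : Subalgebra K (Weyl K)) (hT : T = Algebra.adjoin K {f (Wx K), f (Wy K)})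
    (hPT : f (Wx K) ∈ T) (hQT : f (Wy K) ∈ T)
    (γ : T → T) (hγ : IsInvolutionOn K γ)
    (hγP : γ ⟨f (Wx K), hPT⟩ = ⟨f (Wy K), hQT⟩)
    (hγQ : γ ⟨f (Wy K), hQT⟩ = ⟨f (Wx K), hPT⟩)
    (hαT : ∀ x ∈ T, α x ∈ T)
    (hconj : ∃ g : T → T, (IsAlgAuto K g ∨ IsAntiAuto K g) ∧
      ∀ t : T, γ t = Function.invFun g ⟨α ↑(g t), hαT _ (g t).2⟩) :
    IsAlgAuto K f := by
  obtain ⟨g, hg, hconj⟩ := hconj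
  have hbij : Function.Bijective g := by
    rcases hg with hg | hg
    · exact hg.2
    · exact hg.2
  have hgγ : ∀ t, (g (γ t) : Weyl K) = α (g t) := by
    intro t
    rw [hconj t, Function.rightInverse_invFun hbij.2]
  have hf' := hf
  obtain ⟨fa, fs, fm, f1⟩ := hf
  let F : Weyl K →ₐ[K] Weyl K :=
    { toFun := f
      map_one' := f1
      map_mul' := fm
      map_zero' := by
        have := fs 0 0
        rwa [zero_smul, zero_smul] at this
      map_add' := fa
      commutes' := fun r => by
        rw [Algebra.algebraMap_eq_smul_one, fs, f1] }
  have hrel : f (Wy K) * f (Wx K) = f (Wx K) * f (Wy K) + 1 := by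
    rw [← fm, Weyl_rel, fa, fm, f1]
  have hrel' : (⟨f (Wy K), hQT⟩ : T) * ⟨f (Wx K), hPT⟩ = ⟨f (Wx K), hPT⟩ * ⟨f (Wy K), hQT⟩ + 1 :=
    Subtype.ext hrel
  have e1 := hgγ ⟨f (Wx K), hPT⟩
  have e2 := hgγ ⟨f (Wy K), hQT⟩
  rw [hγP] at e1
  rw [hγQ] at e2
  have hTtop : T = ⊤ := by
    rcases hg with hg | hg
    · obtain ⟨⟨ga, gs, gm, g1⟩, _⟩ := hg
      have e3 := congrArg (fun t => ((g t : T) : Weyl K)) hrel'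
      simp only [gm, ga, g1] at e3
      have e4 := adjoin_top hα (P := (g ⟨f (Wx K), hPT⟩ : T)) (Q := (g ⟨f (Wy K), hQT⟩ : T)) e3
        e1.symm e2.symm
      rw [eq_top_iff, ← e4]
      apply Algebra.adjoin_le
      rintro x (rfl | rfl)
      · exact Subtype.property _
      · exact Subtype.property _
    · obtain ⟨⟨ga, gs, gm, g1⟩, _⟩ := hg
      have e3 := congrArg (fun t => ((g t : T) : Weyl K)) hrel'
      simp only [gm, ga, g1] at e3
      have e4 := adjoin_top hα (P := (g ⟨f (Wy K), hQT⟩ : T)) (Q := (g ⟨f (Wx K), hPT⟩ : T)) e3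
        e2.symm e1.symm
      rw [eq_top_iff, ← e4]
      apply Algebra.adjoin_le
      rintro x (rfl | rfl)
      · exact Subtype.property _
      · exact Subtype.property _
  refine ⟨hf', endo_inj F, ?_⟩
  intro w
  have hw : w ∈ Algebra.adjoin K {f (Wx K), f (Wy K)} := by
    rw [← hT, hTtop]; trivial
  have hle : Algebra.adjoin K {f (Wx K), f (Wy K)} ≤ F.range := by
    apply Algebra.adjoin_le
    rintro x (rfl | rfl)
    · exact ⟨Wx K, rfl⟩
    · exact ⟨Wy K, rfl⟩
  obtain ⟨v, hv⟩ := hle hw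
  exact ⟨v, hv⟩
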